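/- arXiv:1607.01530 — 2 statements merged into one kernel-verified Lean document; each statement's English description precedes it below -/
import Mathlib

section
/- Fix δ > 0. There exists P₀ = P₀(δ) such that for every prime p ≥ P₀, every subgroup H of (ℤ/pℤ)ˣ with |H| ≥ p^{1/2+δ}, and all a, b ∈ (ℤ/pℤ)ˣ with ab ≠ 1, there exist t ∈ H and y ∈ (ℤ/pℤ)ˣ such that y generates the cyclic group (ℤ/pℤ)ˣ (i.e. y is a primitive root mod p) and a·t + b·t⁻¹ = y + y⁻¹. -/
open Polynomial
open scoped QuadraticAlgebra

/-- The ring `A[ω]` with `ω² = (a τ² + b) ω - τ²`: the functions on the curve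
`a τ + b / τ = y + 1 / y`, where `ω` stands for `τ y`. -/
abbrev MarkoffRing {A : Type*} [CommRing A] (a b τ : A) : Type _ :=
  QuadraticAlgebra A (-(τ ^ 2)) (a * τ ^ 2 + b)

/-- The coordinate ring of the curve `a t + b / t = y + 1 / y` over `k`. -/
abbrev MarkoffCurve {k : Type*} [CommRing k] (a b : k) : Type _ :=
  MarkoffRing (C a) (C b) (X : k[X])

namespace MarkoffCurve

variable {k : Type*} [Field k] {a b : k}

/-- The derivation `t V d/dt` of the coordinate ring, where `V = 2 ω - (a t² + b)`. -/
noncomputable def der (a b : k) : Derivation k (MarkoffCurve a b) (MarkoffCurve a b) :=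
  Derivation.mk'
    { toFun := fun f => ⟨-(X * derivative f.re * (C a * X ^ 2 + C b))
          - 2 * X ^ 3 * derivative f.im - 2 * X ^ 2 * f.im,
        2 * X * derivative f.re + X * derivative f.im * (C a * X ^ 2 + C b)
          + 2 * C a * X ^ 2 * f.im⟩
      map_add' := fun f g => by
        ext1 <;> simp <;> ring
      map_smul' := fun c f => by
        ext1 <;> simp [smul_eq_C_mul] <;> ring }
    (fun f g => by
      ext1 <;> simp <;> ring)

lemma re_der (f : MarkoffCurve a b) : (der a b f).re =
    -(X * derivative f.re * (C a * X ^ 2 + C b)) - 2 * X ^ 3 * derivative f.im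
      - 2 * X ^ 2 * f.im := rfl

lemma im_der (f : MarkoffCurve a b) : (der a b f).im =
    2 * X * derivative f.re + X * derivative f.im * (C a * X ^ 2 + C b)
      + 2 * C a * X ^ 2 * f.im := rfl

lemma star_der (f : MarkoffCurve a b) : star (der a b f) = -der a b (star f) := by
  ext1 <;> simp [re_der, im_der] <;> ring

/-- The function `2 ω - (a t² + b)`, whose zeros are the ramification points. -/
noncomputable def vel (a b : k) : MarkoffCurve a b := ⟨-(C a * X ^ 2 + C b), 2⟩

/-- The function `a t² - b`. -/
noncomputable def skew (a b : k) : MarkoffCurve a b := ⟨C a * X ^ 2 - C b, 0⟩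

/-- The function `t`. -/
noncomputable def crd (a b : k) : MarkoffCurve a b := ⟨X, 0⟩

lemma der_crd : der a b (crd a b) = crd a b * vel a b := by
  ext1 <;> simp [re_der, im_der, crd, vel] <;> ring

lemma der_omega : der a b ω = ω * (vel a b + skew a b) := by
  ext1 <;> simp [re_der, im_der, skew, vel] <;> ring

/-- The twisted derivation `δ + n₁ V + n₂ (V + S)`. -/
noncomputable def twist (a b : k) (n₁ n₂ : ℕ) : MarkoffCurve a b →ₗ[k] MarkoffCurve a b :=
  (der a b).toLinearMap +
    LinearMap.mulLeft k ((n₁ : MarkoffCurve a b) * vel a b + n₂ * (vel a b + skew a b))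

lemma twist_apply (n₁ n₂ : ℕ) (f : MarkoffCurve a b) : twist a b n₁ n₂ f =
    der a b f + ((n₁ : MarkoffCurve a b) * vel a b + n₂ * (vel a b + skew a b)) * f := rfl

lemma der_pow_self {f g : MarkoffCurve a b} (h : der a b f = f * g) (n : ℕ) :
    der a b (f ^ n) = f ^ n * (n * g) := by
  induction n with
  | zero => simp
  | succ n ih => rw [pow_succ f n, Derivation.leibniz, ih, h]; simp; ring

lemma der_mul_twist (n₁ n₂ : ℕ) (f : MarkoffCurve a b) :
    der a b (crd a b ^ n₁ * ω ^ n₂ * f) = crd a b ^ n₁ * ω ^ n₂ * twist a b n₁ n₂ f := by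
  rw [Derivation.leibniz, Derivation.leibniz, der_pow_self der_crd, der_pow_self der_omega,
    twist_apply]
  simp only [smul_eq_mul]
  ring

lemma iterate_der_mul_twist (n₁ n₂ r : ℕ) (f : MarkoffCurve a b) :
    (der a b)^[r] (crd a b ^ n₁ * ω ^ n₂ * f) =
      crd a b ^ n₁ * ω ^ n₂ * (twist a b n₁ n₂)^[r] f := by
  induction r generalizing f with
  | zero => rfl
  | succ r ih => rw [Function.iterate_succ_apply, der_mul_twist, ih, ← Function.iterate_succ_apply]

/-- Evaluation at a point `(t, w)` of the curve. -/
noncomputable def ev (t w : k) (h : w * w = -(t ^ 2) + (a * t ^ 2 + b) * w) :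
    MarkoffCurve a b →+* k where
  toFun f := f.re.eval t + f.im.eval t * w
  map_one' := by simp
  map_zero' := by simp
  map_add' f g := by simp; ring
  map_mul' f g := by
    simp
    linear_combination -(eval t f.im * eval t g.im) * h

lemma ev_apply {t w : k} (h : w * w = -(t ^ 2) + (a * t ^ 2 + b) * w) (f : MarkoffCurve a b) :
    ev t w h f = f.re.eval t + f.im.eval t * w := rfl

lemma ev_star {t w : k} (h : w * w = -(t ^ 2) + (a * t ^ 2 + b) * w)
    (h' : (a * t ^ 2 + b - w) * (a * t ^ 2 + b - w) =
      -(t ^ 2) + (a * t ^ 2 + b) * (a * t ^ 2 + b - w)) (f : MarkoffCurve a b) :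
    ev t w h (star f) = ev t (a * t ^ 2 + b - w) h' f := by
  simp [ev_apply]; ring

/-- A function vanishes to order at least `n` along the derivation `der`, at the point given by
the evaluation homomorphism `φ`. -/
def VanishesTo (φ : MarkoffCurve a b →+* k) (n : ℕ) (f : MarkoffCurve a b) : Prop :=
  ∀ r < n, φ ((der a b)^[r] f) = 0

variable {φ : MarkoffCurve a b →+* k}

lemma vanishesTo_zero (f : MarkoffCurve a b) : VanishesTo φ 0 f := fun _ hr => absurd hr (by simp)

lemma vanishesTo_succ {n : ℕ} {f : MarkoffCurve a b} :
    VanishesTo φ (n + 1) f ↔ φ f = 0 ∧ VanishesTo φ n (der a b f) := by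
  constructor
  · exact fun h => ⟨h 0 (by simp), fun r hr => h (r + 1) (by simpa using hr)⟩
  · rintro ⟨h0, h⟩ (_ | r) hr
    · exact h0
    · exact h r (by simpa using hr)

lemma VanishesTo.mono {m n : ℕ} (hmn : m ≤ n) {f : MarkoffCurve a b} (h : VanishesTo φ n f) :
    VanishesTo φ m f := fun r hr => h r (hr.trans_le hmn)

lemma iterate_der_add (r : ℕ) (f g : MarkoffCurve a b) :
    (der a b)^[r] (f + g) = (der a b)^[r] f + (der a b)^[r] g :=
  iterate_map_add (der a b) r f g

lemma VanishesTo.add {n : ℕ} {f g : MarkoffCurve a b} (hf : VanishesTo φ n f)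
    (hg : VanishesTo φ n g) : VanishesTo φ n (f + g) := fun r hr => by
  rw [iterate_der_add, map_add, hf r hr, hg r hr, add_zero]

lemma VanishesTo.mul {n m : ℕ} {f g : MarkoffCurve a b} (hf : VanishesTo φ n f)
    (hg : VanishesTo φ m g) : VanishesTo φ (n + m) (f * g) := by
  induction hN : n + m generalizing n m f g with
  | zero => exact vanishesTo_zero _
  | succ N ih =>
    rw [vanishesTo_succ]
    refine ⟨?_, ?_⟩
    · rw [map_mul]
      rcases Nat.eq_zero_or_pos n with rfl | hn
      · rw [show φ g = 0 from hg 0 (by lia), mul_zero]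
      · rw [show φ f = 0 from hf 0 hn, zero_mul]
    · rw [Derivation.leibniz, smul_eq_mul, smul_eq_mul]
      refine VanishesTo.add ?_ ?_
      · rcases m with _ | m
        · obtain ⟨n, rfl⟩ : ∃ n', n = n' + 1 := ⟨N, by lia⟩
          exact ih (hf.mono (Nat.le_succ n)) (vanishesTo_zero _) (by lia)
        · exact ih hf (vanishesTo_succ.1 hg).2 (by lia)
      · rcases n with _ | n
        · obtain ⟨m, rfl⟩ : ∃ m', m = m' + 1 := ⟨N, by lia⟩
          exact ih (hg.mono (Nat.le_succ m)) (vanishesTo_zero _) (by lia)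
        · exact ih hg (vanishesTo_succ.1 hf).2 (by lia)

lemma iterate_der_star (r : ℕ) (f : MarkoffCurve a b) :
    (der a b)^[r] (star f) = (-1) ^ r * star ((der a b)^[r] f) := by
  induction r with
  | zero => simp
  | succ r ih =>
    rw [Function.iterate_succ_apply', ih, Function.iterate_succ_apply', star_der]
    rcases neg_one_pow_eq_or (MarkoffCurve a b) r with h | h <;> simp [pow_succ, h]

lemma VanishesTo.star {t w : k} {h : w * w = -(t ^ 2) + (a * t ^ 2 + b) * w}
    {h' : (a * t ^ 2 + b - w) * (a * t ^ 2 + b - w) =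
      -(t ^ 2) + (a * t ^ 2 + b) * (a * t ^ 2 + b - w)} {n : ℕ} {f : MarkoffCurve a b}
    (hf : VanishesTo (ev t (a * t ^ 2 + b - w) h') n f) : VanishesTo (ev t w h) n (star f) := by
  intro r hr
  rw [iterate_der_star, map_mul, ev_star h h', hf r hr, mul_zero]

lemma map_iterate_der_pow_mul {u : MarkoffCurve a b} (hu : φ u = 0) (r : ℕ)
    (g : MarkoffCurve a b) :
    φ ((der a b)^[r] (u ^ r * g)) = r.factorial * φ (der a b u) ^ r * φ g := by
  induction r generalizing g with
  | zero => simp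
  | succ r ih =>
    have : der a b (u ^ (r + 1) * g) =
        u ^ r * (((r + 1 : ℕ) : MarkoffCurve a b) * der a b u * g + u * der a b g) := by
      rw [Derivation.leibniz, Derivation.leibniz_pow]
      simp only [smul_eq_mul, nsmul_eq_mul, Nat.add_sub_cancel]
      ring
    rw [Function.iterate_succ_apply, this, ih]
    simp [hu, Nat.factorial_succ]
    ring

/-- The order of vanishing of a polynomial in `t` at an unramified point is at most its order of
vanishing on the line, as long as the latter is less than the characteristic. -/
lemma le_rootMultiplicity (p : ℕ) [CharP k p] (hp : p.Prime) {t w : k} (ht : t ≠ 0)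
    (h : w * w = -(t ^ 2) + (a * t ^ 2 + b) * w) (hw : 2 * w ≠ a * t ^ 2 + b) {n : ℕ}
    (hn : n ≤ p) {N : k[X]} (hN : N ≠ 0)
    (hv : VanishesTo (ev t w h) n (algebraMap k[X] (MarkoffCurve a b) N)) :
    n ≤ N.rootMultiplicity t := by
  by_contra! hlt
  obtain ⟨g, hg, hgt⟩ := exists_eq_pow_rootMultiplicity_mul_and_not_dvd N hN t
  set r := N.rootMultiplicity t
  have h1 := hv r hlt
  rw [hg, map_mul, map_pow, map_iterate_der_pow_mul (by simp [ev_apply])] at h1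
  have h2 : ev t w h (der a b (algebraMap k[X] (MarkoffCurve a b) (X - C t))) =
      t * (2 * w - (a * t ^ 2 + b)) := by
    simp [ev_apply, re_der, im_der]; ring
  rw [h2] at h1
  simp only [mul_eq_zero, pow_eq_zero_iff', sub_eq_zero] at h1
  rcases h1 with (h1 | h1) | h1
  · have := (CharP.cast_eq_zero_iff k p _).1 h1
    exact absurd ((hp.dvd_factorial).1 this) (by lia)
  · simp [ht, hw] at h1
  · apply hgt
    rw [dvd_iff_isRoot]
    simpa [ev_apply] using h1

end MarkoffCurve

namespace MarkoffCurve

variable {k : Type*} [Field k] {a b : k}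

/-- Both coordinates of `f` have degree less than `n`. -/
def DegLT (n : ℕ) (f : MarkoffCurve a b) : Prop := f.re.degree < n ∧ f.im.degree < n

lemma degree_mul_lt {p q : k[X]} {i n : ℕ} (hp : p.degree ≤ i) (hq : q.degree < n) :
    (p * q).degree < ((n + i : ℕ) : WithBot ℕ) := by
  rcases eq_or_ne q 0 with rfl | hq0
  · simp
  rcases eq_or_ne p 0 with rfl | hp0
  · simp
  rw [degree_mul, degree_eq_natDegree hp0, degree_eq_natDegree hq0] at *
  norm_cast at *
  lia

lemma degree_X_mul_derivative_lt {q : k[X]} {n : ℕ} (hq : q.degree < n) :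
    (X * derivative q : k[X]).degree < (n : WithBot ℕ) := by
  rw [degree_lt_iff_coeff_zero] at hq ⊢
  rintro (_ | m) hm
  · simp
  · rw [coeff_X_mul, coeff_derivative, hq _ hm, zero_mul]

lemma degree_quadratic_le (u v : k) : (C u * X ^ 2 + C v).degree ≤ ((2 : ℕ) : WithBot ℕ) := by
  compute_degree
  norm_num

lemma DegLT.twist {n : ℕ} {f : MarkoffCurve a b} (hf : DegLT n f) (n₁ n₂ : ℕ) :
    DegLT (n + 2) (twist a b n₁ n₂ f) := by
  obtain ⟨h1, h2⟩ := hf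
  have h1' := degree_X_mul_derivative_lt h1
  have h2' := degree_X_mul_derivative_lt h2
  have key : ∀ (u v : k) {q : k[X]}, q.degree < n →
      (C u * X ^ 2 + C v) * q ∈ degreeLT k (n + 2) := fun u v q hq =>
    mem_degreeLT.2 (degree_mul_lt (degree_quadratic_le u v) hq)
  have hC : (C 2 : k[X]) = 2 := map_ofNat C 2
  refine ⟨?_, ?_⟩
  · have : (MarkoffCurve.twist a b n₁ n₂ f).re =
        (C (-a) * X ^ 2 + C (-b)) * (X * derivative f.re) +
        (C (-2) * X ^ 2 + C 0) * (X * derivative f.im) +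
        (C (-2) * X ^ 2 + C 0) * f.im +
        (C (-(n₁ : k) * a) * X ^ 2 + C (-((n₁ : k) + 2 * n₂) * b)) * f.re +
        (C (-2 * ((n₁ : k) + n₂)) * X ^ 2 + C 0) * f.im := by
      simp [twist_apply, re_der, vel, skew, hC]
      ring
    rw [this]
    exact mem_degreeLT.1 (add_mem (add_mem (add_mem (add_mem (key _ _ h1') (key _ _ h2'))
      (key _ _ h2)) (key _ _ h1)) (key _ _ h2))
  · have : (MarkoffCurve.twist a b n₁ n₂ f).im =
        (C 0 * X ^ 2 + C 2) * (X * derivative f.re) +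
        (C a * X ^ 2 + C b) * (X * derivative f.im) +
        (C (2 * a) * X ^ 2 + C 0) * f.im +
        (C (((n₁ : k) + 2 * n₂) * a) * X ^ 2 + C ((n₁ : k) * b)) * f.im +
        (C 0 * X ^ 2 + C (2 * ((n₁ : k) + n₂))) * f.re := by
      simp [twist_apply, im_der, vel, skew, hC]
      ring
    rw [this]
    exact mem_degreeLT.1 (add_mem (add_mem (add_mem (add_mem (key _ _ h1') (key _ _ h2'))
      (key _ _ h2)) (key _ _ h2)) (key _ _ h1))

lemma DegLT.iterate_twist {n : ℕ} {f : MarkoffCurve a b} (hf : DegLT n f) (n₁ n₂ r : ℕ) :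
    DegLT (n + 2 * r) ((MarkoffCurve.twist a b n₁ n₂)^[r] f) := by
  induction r with
  | zero => exact hf
  | succ r ih => rw [Function.iterate_succ_apply']; exact ih.twist n₁ n₂

/-- The function with given coordinates of degree less than `n`. -/
noncomputable def ofDegreeLT (a b : k) (n : ℕ) :
    (degreeLT k n × degreeLT k n) →ₗ[k] MarkoffCurve a b where
  toFun q := ⟨q.1, q.2⟩
  map_add' _ _ := rfl
  map_smul' _ _ := rfl

lemma degLT_ofDegreeLT {n : ℕ} (q : degreeLT k n × degreeLT k n) :
    DegLT n (ofDegreeLT a b n q) := ⟨mem_degreeLT.1 q.1.2, mem_degreeLT.1 q.2.2⟩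

/-- The coefficients of the two coordinates of a function. -/
noncomputable def coeffs (a b : k) (n : ℕ) : MarkoffCurve a b →ₗ[k] (Fin n → k × k) where
  toFun f i := (f.re.coeff i, f.im.coeff i)
  map_add' f g := by ext <;> simp
  map_smul' c f := by ext <;> simp

lemma eq_zero_of_coeffs {n : ℕ} {f : MarkoffCurve a b} (hf : DegLT n f)
    (h : coeffs a b n f = 0) : f = 0 := by
  have h' : ∀ i < n, f.re.coeff i = 0 ∧ f.im.coeff i = 0 := fun i hi => by
    simpa [coeffs, Prod.ext_iff] using congrFun h ⟨i, hi⟩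
  ext i
  · by_cases hi : i < n
    · simpa using (h' i hi).1
    · simpa using (degree_lt_iff_coeff_zero _ _).1 hf.1 i (by lia)
  · by_cases hi : i < n
    · simpa using (h' i hi).2
    · simpa using (degree_lt_iff_coeff_zero _ _).1 hf.2 i (by lia)

lemma exists_auxiliary (a b c : k) (n₁ n₂ : ℕ → ℕ → ℕ) {I J M d : ℕ}
    (h : M * (2 * (d + 2 * M)) < I * J * (2 * d)) :
    ∃ g : ℕ → ℕ → MarkoffCurve a b, (∀ i j, DegLT d (g i j)) ∧
      (∃ i < I, ∃ j < J, g i j ≠ 0) ∧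
      ∀ r < M, ∑ i ∈ Finset.range I, ∑ j ∈ Finset.range J,
        c ^ j • (twist a b (n₁ i j) (n₂ i j))^[r] (g i j) = 0 := by
  let D := Fin I → Fin J → degreeLT k d × degreeLT k d
  let F : D →ₗ[k] (Fin M → Fin (d + 2 * M) → k × k) := LinearMap.pi fun r =>
    coeffs a b (d + 2 * M) ∘ₗ ∑ i : Fin I, ∑ j : Fin J,
      c ^ (j : ℕ) • ((twist a b (n₁ i j) (n₂ i j) ^ (r : ℕ)) ∘ₗ ofDegreeLT a b d ∘ₗ
        LinearMap.proj j ∘ₗ LinearMap.proj (φ := fun _ : Fin I => Fin J → _) i)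
  have hfin : Module.finrank k (degreeLT k d) = d := by
    rw [(degreeLTEquiv k d).finrank_eq]; simp
  have : Module.Finite k (degreeLT k d) := Module.Finite.equiv (degreeLTEquiv k d).symm
  have hker : LinearMap.ker F ≠ ⊥ := by
    apply LinearMap.ker_ne_bot_of_finrank_lt
    simp only [D, Module.finrank_pi_fintype, Module.finrank_prod, hfin, Module.finrank_self]
    simp
    nlinarith
  obtain ⟨q, hq, hq0⟩ := (Submodule.ne_bot_iff _).1 hker
  let g : ℕ → ℕ → MarkoffCurve a b := fun i j =>
    if hi : i < I then if hj : j < J then ofDegreeLT a b d (q ⟨i, hi⟩ ⟨j, hj⟩) else 0 else 0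
  have hg : ∀ (i : Fin I) (j : Fin J), g i j = ofDegreeLT a b d (q i j) := fun i j => by simp [g]
  have hdeg : ∀ i j, DegLT d (g i j) := fun i j => by
    simp only [g]
    split_ifs
    · exact degLT_ofDegreeLT _
    · simp [DegLT]
    · simp [DegLT]
  refine ⟨g, hdeg, ?_, ?_⟩
  · by_contra! hcon
    apply hq0
    ext i j : 2
    have := hcon i i.2 j j.2
    rw [hg] at this
    have h1 := congrArg QuadraticAlgebra.re this
    have h2 := congrArg QuadraticAlgebra.im this
    exact Prod.ext (Subtype.ext h1) (Subtype.ext h2)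
  · intro r hr
    have hmem : ∀ f : MarkoffCurve a b, DegLT (d + 2 * M) f ↔
        f.re ∈ degreeLT k (d + 2 * M) ∧ f.im ∈ degreeLT k (d + 2 * M) := fun f => by
      simp only [mem_degreeLT, DegLT]
    apply eq_zero_of_coeffs (n := d + 2 * M)
    · have : ∀ i j, DegLT (d + 2 * M) (c ^ j • (twist a b (n₁ i j) (n₂ i j))^[r] (g i j)) := by
        intro i j
        have h1 := (hdeg i j).iterate_twist (n₁ i j) (n₂ i j) r
        rw [hmem]
        constructor
        · exact Submodule.smul_mem _ _ (mem_degreeLT.2 (h1.1.trans_le (by norm_cast; lia)))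
        · exact Submodule.smul_mem _ _ (mem_degreeLT.2 (h1.2.trans_le (by norm_cast; lia)))
      have hre : ∀ (s : Finset ℕ) (f : ℕ → MarkoffCurve a b), (∀ i, DegLT (d + 2 * M) (f i)) →
          DegLT (d + 2 * M) (∑ i ∈ s, f i) := by
        intro s f hf
        induction s using Finset.induction_on with
        | empty => rw [hmem]; simp
        | insert x s hx ih =>
          rw [Finset.sum_insert hx]
          rw [hmem] at ih ⊢
          exact ⟨add_mem ((hmem _).1 (hf x)).1 ih.1, add_mem ((hmem _).1 (hf x)).2 ih.2⟩
      exact hre _ _ fun i => hre _ _ fun j => this i j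
    · have h1 := congrFun (LinearMap.mem_ker.1 hq) ⟨r, hr⟩
      simp only [F, LinearMap.pi_apply, LinearMap.comp_apply, LinearMap.sum_apply,
        LinearMap.smul_apply, LinearMap.proj_apply, Module.End.pow_apply] at h1
      refine Eq.trans ?_ h1
      congr 1
      rw [← Fin.sum_univ_eq_sum_range (fun i => ∑ j ∈ Finset.range J,
        c ^ j • (twist a b (n₁ i j) (n₂ i j))^[r] (g i j))]
      refine Finset.sum_congr rfl fun i _ => ?_
      rw [← Fin.sum_univ_eq_sum_range (fun j =>
        c ^ j • (twist a b (n₁ i j) (n₂ i j))^[r] (g i j))]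
      exact Finset.sum_congr rfl fun j _ => by rw [hg]; rfl

/-- The order of the pole of `f` at infinity is at most `n`, where `ω` has a pole of order `2`. -/
def PoleLE (n : ℕ) (f : MarkoffCurve a b) : Prop :=
  f.re.natDegree ≤ n ∧ (X ^ 2 * f.im).natDegree ≤ n

lemma natDegree_le_of_X_sq_mul {q : k[X]} {n : ℕ} (h : (X ^ 2 * q).natDegree ≤ n) :
    q.natDegree ≤ n := by
  rcases eq_or_ne q 0 with rfl | hq
  · simp
  · rw [natDegree_mul (by simp) hq] at h
    lia

lemma natDegree_C_mul_le_of_le (u : k) {q : k[X]} {n : ℕ} (h : q.natDegree ≤ n) :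
    (C u * q).natDegree ≤ n := (natDegree_C_mul_le u q).trans h

lemma PoleLE.mul {n m : ℕ} {f g : MarkoffCurve a b} (hf : PoleLE n f) (hg : PoleLE m g) :
    PoleLE (n + m) (f * g) := by
  obtain ⟨hf1, hf2⟩ := hf
  obtain ⟨hg1, hg2⟩ := hg
  have hf3 := natDegree_le_of_X_sq_mul hf2
  have hg3 := natDegree_le_of_X_sq_mul hg2
  constructor
  · have : (f * g).re = f.re * g.re + -(f.im * (X ^ 2 * g.im)) := by simp; ring
    rw [this]
    refine natDegree_add_le_of_degree_le (natDegree_mul_le_of_le hf1 hg1) ?_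
    rw [natDegree_neg]
    exact natDegree_mul_le_of_le hf3 hg2
  · have : X ^ 2 * (f * g).im = f.re * (X ^ 2 * g.im) + (X ^ 2 * f.im) * g.re
        + (C a * ((X ^ 2 * f.im) * (X ^ 2 * g.im)) + C b * (f.im * (X ^ 2 * g.im))) := by
      simp; ring
    rw [this]
    refine natDegree_add_le_of_degree_le (natDegree_add_le_of_degree_le
      (natDegree_mul_le_of_le hf1 hg2) (natDegree_mul_le_of_le hf2 hg1))
      (natDegree_add_le_of_degree_le (natDegree_C_mul_le_of_le _ (natDegree_mul_le_of_le hf2 hg2))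
        (natDegree_C_mul_le_of_le _ (natDegree_mul_le_of_le hf3 hg2)))

lemma PoleLE.pow {n : ℕ} {f : MarkoffCurve a b} (hf : PoleLE n f) (r : ℕ) :
    PoleLE (r * n) (f ^ r) := by
  induction r with
  | zero => simp [PoleLE, QuadraticAlgebra.re_one, QuadraticAlgebra.im_one]
  | succ r ih => rw [pow_succ f r, Nat.succ_mul]; exact ih.mul hf

lemma PoleLE.mono {n m : ℕ} (h : n ≤ m) {f : MarkoffCurve a b} (hf : PoleLE n f) : PoleLE m f :=
  ⟨hf.1.trans h, hf.2.trans h⟩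

lemma PoleLE.sum {ι : Type*} (s : Finset ι) {n : ℕ} {f : ι → MarkoffCurve a b}
    (hf : ∀ i ∈ s, PoleLE n (f i)) : PoleLE n (∑ i ∈ s, f i) := by
  classical
  induction s using Finset.induction_on with
  | empty => simp [PoleLE]
  | insert x s hx ih =>
    rw [Finset.sum_insert hx]
    obtain ⟨h1, h2⟩ := hf x (by simp)
    obtain ⟨h3, h4⟩ := ih fun i hi => hf i (by simp [hi])
    refine ⟨natDegree_add_le_of_degree_le h1 h3, ?_⟩
    rw [QuadraticAlgebra.im_add, mul_add]
    exact natDegree_add_le_of_degree_le h2 h4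

lemma poleLE_crd : PoleLE 1 (crd a b) := by simp [PoleLE, crd]

lemma poleLE_omega : PoleLE 2 (ω : MarkoffCurve a b) := by simp [PoleLE]

lemma DegLT.poleLE {n : ℕ} {f : MarkoffCurve a b} (hf : DegLT n f) : PoleLE (n + 1) f := by
  obtain ⟨h1, h2⟩ := hf
  constructor
  · rcases eq_or_ne f.re 0 with h | h
    · simp [h]
    · rw [degree_eq_natDegree h] at h1
      norm_cast at h1
      lia
  · rcases eq_or_ne f.im 0 with h | h
    · simp [h]
    · rw [degree_eq_natDegree h] at h2
      rw [natDegree_mul (by simp) h, natDegree_X_pow]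
      norm_cast at h2
      lia

lemma PoleLE.natDegree_norm_le {n : ℕ} {f : MarkoffCurve a b} (hf : PoleLE n f) :
    (QuadraticAlgebra.norm f).natDegree ≤ 2 * n := by
  obtain ⟨h1, h2⟩ := hf
  have h3 := natDegree_le_of_X_sq_mul h2
  have : QuadraticAlgebra.norm f = f.re * f.re +
      (C a * (f.re * (X ^ 2 * f.im)) + C b * (f.re * f.im)) + f.im * (X ^ 2 * f.im) := by
    rw [QuadraticAlgebra.norm_def]; ring
  rw [this, two_mul]
  exact natDegree_add_le_of_degree_le (natDegree_add_le_of_degree_le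
    (natDegree_mul_le_of_le h1 h1) (natDegree_add_le_of_degree_le
      (natDegree_C_mul_le_of_le _ (natDegree_mul_le_of_le h1 h2))
      (natDegree_C_mul_le_of_le _ (natDegree_mul_le_of_le h1 h3))))
    (natDegree_mul_le_of_le h3 h2)

end MarkoffCurve

section RatFunc

variable {F : Type*} [Field F]

local notation "ι" => algebraMap F[X] (RatFunc F)

lemma markoff_no_root {a b t : F} (ha : a ≠ 0) (ht : t ≠ 0) (hab : a * b ≠ 1) {m : ℕ}
    (hm : 0 < m) (r : RatFunc F) :
    r ^ 2 ≠ -((RatFunc.C t * RatFunc.X ^ m) ^ 2)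
      + (RatFunc.C a * (RatFunc.C t * RatFunc.X ^ m) ^ 2 + RatFunc.C b) * r := by
  intro hr
  have hint : IsIntegral F[X] r := by
    refine ⟨X ^ 2 - C (C a * (C t * X ^ m) ^ 2 + C b) * X + C ((C t * X ^ m) ^ 2), ?_, ?_⟩
    · monicity!
    · simp only [eval₂_add, eval₂_sub, eval₂_mul, eval₂_pow, eval₂_X, eval₂_C, map_add, map_mul,
        map_pow, RatFunc.algebraMap_C, RatFunc.algebraMap_X]
      linear_combination hr
  obtain ⟨q, rfl⟩ := IsIntegrallyClosed.isIntegral_iff.1 hint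
  have hq : q ^ 2 = -((C t * X ^ m) ^ 2) + (C a * (C t * X ^ m) ^ 2 + C b) * q := by
    apply IsFractionRing.injective F[X] (RatFunc F)
    simpa using hr
  have hdvd : q ∣ X ^ (2 * m) := by
    refine ⟨C (t ^ 2)⁻¹ * (C a * (C t * X ^ m) ^ 2 + C b - q), ?_⟩
    have h1 : C (t ^ 2)⁻¹ * (C t * C t) = (1 : F[X]) := by
      rw [← C_mul, ← C_mul, ← C_1]; congr 1; field_simp
    linear_combination C (t ^ 2)⁻¹ * hq - X ^ (2 * m) * h1
  obtain ⟨i, hi, hqi⟩ := (dvd_prime_pow prime_X _).1 hdvd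
  obtain ⟨c, hc, rfl⟩ : ∃ c : F, c ≠ 0 ∧ q = C c * X ^ i := by
    obtain ⟨u, hu⟩ := hqi.symm
    obtain ⟨c, hc, hcu⟩ := Polynomial.isUnit_iff.1 u.isUnit
    exact ⟨c, hc.ne_zero, by rw [← hu, ← hcu, mul_comm]⟩
  have key : (C (c ^ 2) * X ^ (2 * i) + C (t ^ 2) * X ^ (2 * m) : F[X]) =
      C (a * t ^ 2 * c) * X ^ (2 * m + i) + C (b * c) * X ^ i := by
    simp only [C_mul, C_pow]
    linear_combination hq
  have hco : ∀ n, (if n = 2 * i then c ^ 2 else 0) + (if n = 2 * m then t ^ 2 else 0) =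
      (if n = 2 * m + i then a * t ^ 2 * c else 0) + (if n = i then b * c else 0) := by
    intro n
    have := congrArg (fun q => coeff q n) key
    simpa only [coeff_add, coeff_C_mul_X_pow] using this
  have hne : a * t ^ 2 * c ≠ 0 := by positivity
  rcases Nat.eq_zero_or_pos i with rfl | hi0
  · have h1 := hco 0
    have h2 := hco (2 * m)
    simp [hm.ne'] at h1 h2
    have hcb : c = b := by
      apply mul_right_cancel₀ hc; linear_combination h1
    subst hcb
    apply hab
    apply mul_right_cancel₀ (pow_ne_zero 2 ht)
    linear_combination -h2
  · rcases hi.eq_or_lt with rfl | hlt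
    · have h1 := hco (2 * m)
      have h2 := hco (2 * m + 2 * m)
      simp [two_mul, hm.ne'] at h1 h2
      have hca : c = a * t ^ 2 := by
        apply mul_right_cancel₀ hc; linear_combination h2
      subst hca
      apply hab
      apply mul_right_cancel₀ (pow_ne_zero 2 ht)
      linear_combination -h1
    · have h1 := hco (2 * m + i)
      rw [if_neg (by lia), if_neg (by lia), if_pos rfl, if_neg (by lia)] at h1
      apply hne
      linear_combination -h1

lemma trailingCoeff_pow' (Q : F[X]) (l : ℕ) : (Q ^ l).trailingCoeff = Q.trailingCoeff ^ l := by
  induction l with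
  | zero => rw [pow_zero, pow_zero, trailingCoeff_eq_coeff_zero] <;> simp
  | succ l ih => rw [pow_succ, trailingCoeff_mul, pow_succ, ih]

lemma exists_pow_eq_trailingCoeff {n : RatFunc F} {l i : ℕ} {P : F[X]}
    (h : n ^ l * RatFunc.X ^ i = ι P) : ∃ d : F, d ^ l = P.trailingCoeff := by
  have hd : ι n.denom ≠ 0 := by simpa using n.denom_ne_zero
  have h1 : n.num ^ l * X ^ i = P * n.denom ^ l := by
    apply IsFractionRing.injective F[X] (RatFunc F)
    rw [map_mul, map_mul, map_pow, map_pow, map_pow, RatFunc.algebraMap_X, ← h]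
    nth_rewrite 2 [← RatFunc.num_div_denom n]
    rw [div_pow]
    field_simp
  have hXt : (X : F[X]).trailingCoeff = 1 := by simp [trailingCoeff]
  have h2 := congrArg trailingCoeff h1
  rw [trailingCoeff_mul, trailingCoeff_mul, trailingCoeff_pow', trailingCoeff_pow',
    trailingCoeff_pow', hXt, one_pow, mul_one] at h2
  have h3 : n.denom.trailingCoeff ≠ 0 := by simpa using n.denom_ne_zero
  exact ⟨n.num.trailingCoeff / n.denom.trailingCoeff, by rw [div_pow, h2]; field_simp⟩

lemma exists_pow_eq_of_pow_eq_C {n : RatFunc F} {l : ℕ} {c : F} (h : n ^ l = RatFunc.C c) :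
    ∃ d : F, d ^ l = c := by
  obtain ⟨d, hd⟩ := exists_pow_eq_trailingCoeff (n := n) (l := l) (i := 0) (P := C c)
    (by simpa using h)
  refine ⟨d, hd.trans ?_⟩
  rcases eq_or_ne c 0 with rfl | hc
  · simp
  · rw [trailingCoeff_eq_coeff_zero] <;> simp [hc]

end RatFunc

section Powers

variable {E : Type*} [Field E] {a b : E}

lemma trace_sq (g : QuadraticAlgebra E a b) :
    g.trace ^ 2 = (g ^ 2).trace + 2 * g.norm := by
  simp [QuadraticAlgebra.trace_def, QuadraticAlgebra.norm_def, sq]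
  ring

lemma trace_pow_add_two (g : QuadraticAlgebra E a b) (i : ℕ) :
    (g ^ (i + 2)).trace = g.trace * (g ^ (i + 1)).trace - g.norm * (g ^ i).trace := by
  have h : g ^ (i + 2) = g.trace • g ^ (i + 1) - g.norm • g ^ i := by
    rw [pow_add, QuadraticAlgebra.sq_eq_trace_smul_sub_norm, Algebra.smul_def, Algebra.smul_def,
      Algebra.smul_def]
    ring
  rw [h, map_sub, map_smul, map_smul, smul_eq_mul, smul_eq_mul]

lemma norm_omega (a b : E) : (ω : QuadraticAlgebra E a b).norm = -a := by
  simp [QuadraticAlgebra.norm_def]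

lemma quadratic_norm_smul (c : E) (z : QuadraticAlgebra E a b) : (c • z).norm = c ^ 2 * z.norm := by
  simp [QuadraticAlgebra.norm_def]; ring

/-- For a valuation taking the value `1` on the norm, the valuation of the trace of a power is
either at most `1` or the power of the valuation of the trace. -/
lemma valuation_trace_pow {Γ : Type*} [LinearOrderedCommGroupWithZero Γ] (v : Valuation E Γ)
    (h2 : v 2 ≤ 1) (g : QuadraticAlgebra E a b) (hn : v g.norm = 1) (l : ℕ) :
    v (g ^ l).trace ≤ 1 ∨ v (g ^ l).trace = v g.trace ^ l := by
  rcases le_or_gt (v g.trace) 1 with hu | hu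
  · left
    have : ∀ i, v (g ^ i).trace ≤ 1 ∧ v (g ^ (i + 1)).trace ≤ 1 := by
      intro i
      induction i with
      | zero => simpa using ⟨h2, hu⟩
      | succ i ih =>
        refine ⟨ih.2, ?_⟩
        rw [trace_pow_add_two]
        refine (v.map_sub _ _).trans (max_le ?_ ?_)
        · rw [map_mul]; exact mul_le_one' hu ih.2
        · rw [map_mul, hn, one_mul]; exact ih.1
    exact (this l).1
  · have : ∀ i, v (g ^ i).trace ≤ v g.trace ^ i ∧ v (g ^ (i + 1)).trace = v g.trace ^ (i + 1) := by
      intro i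
      induction i with
      | zero => simpa using h2
      | succ i ih =>
        refine ⟨ih.2.le, ?_⟩
        have h0 : 0 < v g.trace := zero_lt_one.trans hu
        have hlt : v (g.norm * (g ^ i).trace) < v (g.trace * (g ^ (i + 1)).trace) := by
          rw [map_mul, map_mul, hn, one_mul, ih.2]
          refine ih.1.trans_lt ?_
          rw [← pow_succ']
          exact pow_lt_pow_right₀ hu (by lia)
        rw [trace_pow_add_two, v.map_sub_eq_of_lt_left hlt, map_mul, ih.2, ← pow_succ']
    rcases l with _ | l
    · left; simpa using h2
    · right; exact (this l).2

end Powers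

section FirstLevel

variable {k : Type*} [Field k]

local notation "ι" => algebraMap k[X] (RatFunc k)

/-- The function field of the curve `a t + b / t = y + 1 / y`. -/
abbrev MarkoffField (a b : k) : Type _ :=
  MarkoffRing (RatFunc.C a) (RatFunc.C b) (RatFunc.X : RatFunc k)

variable {a b : k}

lemma pow_ne_inv_X_smul_omega (ha : a ≠ 0) {l : ℕ} (hl : 2 ≤ l) (g : MarkoffField a b) :
    g ^ l ≠ (RatFunc.X : RatFunc k)⁻¹ • (ω : MarkoffField a b) := by
  classical
  intro hg
  have hX : (RatFunc.X : RatFunc k) ≠ 0 := RatFunc.X_ne_zero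
  have hn : g.norm ^ l = 1 := by
    rw [← map_pow, hg, quadratic_norm_smul, norm_omega]
    field_simp
  have ht : (g ^ l).trace = RatFunc.C a * RatFunc.X + RatFunc.C b * RatFunc.X⁻¹ := by
    rw [hg, map_smul, QuadraticAlgebra.trace_omega, smul_eq_mul]
    field_simp
  let v := RatFunc.inftyValuation k
  have hc : ∀ c : k, v (RatFunc.C c) ≤ 1 := by
    intro c
    rcases eq_or_ne c 0 with rfl | hc
    · simp
    · exact (RatFunc.inftyValuation.C k hc).le
  have hvn : v g.norm = 1 := by
    have : v g.norm ^ l = 1 := by rw [← map_pow, hn, map_one]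
    exact (pow_eq_one_iff.1 this).resolve_right (by lia)
  have hvX : v RatFunc.X = WithZero.exp 1 := RatFunc.inftyValuation.X k
  have h1 : (1 : WithZero (Multiplicative ℤ)) < WithZero.exp 1 := by
    rw [← WithZero.exp_zero, WithZero.exp_lt_exp]; norm_num
  have hvt : v (g ^ l).trace = WithZero.exp 1 := by
    have e1 : v (RatFunc.C a * RatFunc.X) = WithZero.exp 1 := by
      rw [map_mul, hvX, RatFunc.inftyValuation.C k ha, one_mul]
    rw [ht, Valuation.map_add_eq_of_lt_left, e1]
    rw [e1, map_mul, map_inv₀, hvX]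
    refine lt_of_le_of_lt ?_ h1
    refine mul_le_one' (hc b) (inv_le_one_of_one_le₀ h1.le)
  rcases valuation_trace_pow v (map_ofNat (RatFunc.C (K := k)) 2 ▸ hc 2) g hvn l with h | h
  · rw [hvt] at h
    exact absurd h (not_le.2 h1)
  · rw [hvt] at h
    have hne : v g.trace ≠ 0 := by
      intro h0
      rw [h0, zero_pow (by lia)] at h
      simp at h
    obtain ⟨e, he⟩ : ∃ e : ℤ, v g.trace = WithZero.exp e := ⟨WithZero.log (v g.trace),
      (WithZero.exp_log hne).symm⟩
    rw [he, ← WithZero.exp_nsmul, WithZero.exp_inj] at h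
    have h3 : (l : ℤ) ∣ 1 := ⟨e, by simpa using h⟩
    have := Int.eq_one_of_dvd_one (by positivity) h3
    lia

lemma sq_ne_smul_omega (hb : b ≠ 0) (hab : a * b ≠ 1) (h2 : (2 : k) ≠ 0)
    (g : MarkoffField a b) : g ^ 2 ≠ RatFunc.C b • (ω : MarkoffField a b) := by
  intro hg
  have hn : g.norm ^ 2 = (RatFunc.C b * RatFunc.X) ^ 2 := by
    rw [← map_pow, hg, quadratic_norm_smul, norm_omega]
    ring
  have ht := trace_sq g
  rw [hg, map_smul, QuadraticAlgebra.trace_omega, smul_eq_mul] at ht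
  obtain ⟨ε, hε, hnε⟩ : ∃ ε : k, ε ^ 2 = 1 ∧ g.norm = RatFunc.C ε * (RatFunc.C b * RatFunc.X) := by
    rcases sq_eq_sq_iff_eq_or_eq_neg.1 hn with h | h
    · exact ⟨1, by simp, by simpa using h⟩
    · exact ⟨-1, by simp, by simpa using h⟩
  have hP : g.trace ^ 2 = ι (C (a * b) * X ^ 2 + C (2 * ε * b) * X + C (b ^ 2)) := by
    have hC : (RatFunc.C 2 : RatFunc k) = 2 := map_ofNat _ 2
    rw [ht, hnε]
    simp [hC, RatFunc.algebraMap_C, RatFunc.algebraMap_X]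
    ring
  obtain ⟨q, hq⟩ := IsIntegrallyClosed.exists_algebraMap_eq_of_isIntegral_pow (R := k[X])
    (x := g.trace) (n := 2) (by norm_num) (by rw [hP]; exact isIntegral_algebraMap)
  have hq2 : q ^ 2 = C (a * b) * X ^ 2 + C (2 * ε * b) * X + C (b ^ 2) := by
    apply IsFractionRing.injective k[X] (RatFunc k)
    rw [map_pow, hq, hP]
  have hdeg : q.natDegree ≤ 1 := by
    have h1 : (q ^ 2).natDegree ≤ 2 := by rw [hq2]; compute_degree
    rw [natDegree_pow] at h1
    lia
  obtain ⟨u, v, rfl⟩ := exists_eq_X_add_C_of_natDegree_le_one hdeg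
  have key : C (u ^ 2) * X ^ 2 + C (2 * u * v) * X + C (v ^ 2) =
      C (a * b) * X ^ 2 + C (2 * ε * b) * X + C (b ^ 2) := by
    rw [← hq2]
    simp only [C_mul, C_pow, map_ofNat]
    ring
  have hco : ∀ i, (if i = 2 then u ^ 2 else 0) + (if i = 1 then 2 * u * v else 0)
      + (if i = 0 then v ^ 2 else 0) = (if i = 2 then a * b else 0)
      + (if i = 1 then 2 * ε * b else 0) + (if i = 0 then b ^ 2 else 0) := by
    intro i
    have := congrArg (fun q => coeff q i) key
    simpa only [coeff_add, coeff_C_mul_X_pow, coeff_C_mul_X, coeff_C] using this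
  have k0 : v ^ 2 = b ^ 2 := by simpa using hco 0
  have k1 : 2 * u * v = 2 * ε * b := by simpa using hco 1
  have k2 : u ^ 2 = a * b := by simpa using hco 2
  have k3 : u * v = ε * b := mul_left_cancel₀ h2 (by linear_combination k1)
  apply hab
  apply mul_right_cancel₀ (pow_ne_zero 2 hb)
  linear_combination (u * v + ε * b) * k3 - b ^ 2 * k2 - u ^ 2 * k0 + b ^ 2 * hε

end FirstLevel

section Kummer

variable {L Ω : Type*} [Field L] [Field Ω] [Algebra L Ω] [IsAlgClosed Ω]

lemma kummer_linearIndependent {D : ℕ} (hD : 0 < D) {ζ : L} (hζ : IsPrimitiveRoot ζ D) {s : L}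
    (hs0 : s ≠ 0) (hs : ∀ l : ℕ, l.Prime → ∀ g : L, g ^ l ≠ s) {z : Ω}
    (hz : z ^ D = algebraMap L Ω s) {f : ℕ → L}
    (hf : ∑ j ∈ Finset.range D, algebraMap L Ω (f j) * z ^ j = 0) {j : ℕ} (hj : j < D) :
    f j = 0 := by
  have hinj := (algebraMap L Ω).injective
  have : NeZero D := ⟨hD.ne'⟩
  have hz0 : z ≠ 0 := by
    rintro rfl
    rw [zero_pow hD.ne', eq_comm, map_eq_zero] at hz
    exact hs0 hz
  let P : L[X] := ∑ j ∈ Finset.range D, C (f j) * X ^ j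
  have hPc : P.coeff j = f j := by
    simp [P, coeff_X_pow, hj]
  by_contra hfj
  have hP0 : P ≠ 0 := fun h => hfj (by rw [← hPc, h, coeff_zero])
  have hPz : aeval z P = 0 := by simpa [P] using hf
  have hPdeg : P.natDegree < D := by
    rw [natDegree_lt_iff_degree_lt hP0]
    refine (degree_sum_le _ _).trans_lt ((Finset.sup_lt_iff (by simp)).2 fun i hi => ?_)
    exact (degree_C_mul_X_pow_le i (f i)).trans_lt (by exact_mod_cast Finset.mem_range.1 hi)
  have hint : IsIntegral L z := ⟨X ^ D - C s, monic_X_pow_sub_C s hD.ne', by simp [hz]⟩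
  let q := minpoly L z
  have hq : q.Monic := minpoly.monic hint
  have hr : q.natDegree < D :=
    (natDegree_le_natDegree (minpoly.degree_le_of_ne_zero L z hP0 hPz)).trans_lt hPdeg
  have hr0 : 0 < q.natDegree := minpoly.natDegree_pos hint
  have hsplit : (q.map (algebraMap L Ω)).Splits := IsAlgClosed.splits _
  have hcoeff := hsplit.coeff_zero_eq_prod_roots_of_monic (hq.map _)
  have hcard : (q.map (algebraMap L Ω)).roots.card = q.natDegree := by
    rw [← hsplit.natDegree_eq_card_roots, natDegree_map]
  have hprod : (q.map (algebraMap L Ω)).roots.prod ^ D = (z ^ q.natDegree) ^ D := by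
    rw [← pow_mul, mul_comm, pow_mul, hz, ← hcard]
    nth_rewrite 1 [← Multiset.map_id (q.map (algebraMap L Ω)).roots]
    rw [← Multiset.prod_map_pow]
    simp only [id]
    have : ∀ α ∈ (q.map (algebraMap L Ω)).roots, α ^ D = algebraMap L Ω s := by
      intro α hα
      have h1 : q ∣ X ^ D - C s := minpoly.dvd _ _ (by simp [hz])
      have h2 : aeval α q = 0 := by
        rw [mem_roots', IsRoot, eval_map_algebraMap] at hα
        exact hα.2
      have h3 := aeval_eq_zero_of_dvd_aeval_eq_zero h1 h2
      simpa [sub_eq_zero] using h3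
    rw [Multiset.map_congr rfl this, Multiset.map_const', Multiset.prod_replicate]
  obtain ⟨u, hu⟩ : ∃ u : L, algebraMap L Ω u = z ^ q.natDegree := by
    have hζ' : IsPrimitiveRoot (algebraMap L Ω ζ) D := hζ.map_of_injective hinj
    have h1 : (z ^ q.natDegree / (q.map (algebraMap L Ω)).roots.prod) ^ D = 1 := by
      rw [div_pow, hprod, div_self]
      positivity
    obtain ⟨i, -, hi⟩ := hζ'.eq_pow_of_pow_eq_one h1
    have hne : (q.map (algebraMap L Ω)).roots.prod ≠ 0 := by
      intro h0
      rw [h0, zero_pow hD.ne'] at hprod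
      exact absurd hprod.symm (by positivity)
    refine ⟨ζ ^ i * ((-1) ^ q.natDegree * q.coeff 0), ?_⟩
    rw [map_mul, map_pow, hi, map_mul, map_pow, map_neg, map_one, ← coeff_map, hcoeff,
      natDegree_map, ← mul_assoc ((-1 : Ω) ^ _), ← mul_pow]
    simp only [mul_neg, mul_one, neg_neg, one_pow, one_mul]
    field_simp
  let g := Nat.gcd q.natDegree D
  obtain ⟨u', hu'⟩ : ∃ u' : L, algebraMap L Ω u' = z ^ g := by
    refine ⟨u ^ (Nat.gcdA q.natDegree D) * s ^ (Nat.gcdB q.natDegree D), ?_⟩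
    rw [map_mul, map_zpow₀, map_zpow₀, hu, ← hz, ← zpow_natCast z g, Nat.gcd_eq_gcd_ab,
      zpow_add₀ hz0, zpow_mul, zpow_mul, zpow_natCast, zpow_natCast]
  have hgD : g ∣ D := Nat.gcd_dvd_right _ _
  have hg : g < D := (Nat.le_of_dvd hr0 (Nat.gcd_dvd_left _ _)).trans_lt hr
  obtain ⟨e, he⟩ := hgD
  have he1 : e ≠ 1 := by rintro rfl; lia
  obtain ⟨e', he'⟩ := Nat.minFac_dvd e
  refine hs e.minFac (Nat.minFac_prime he1) (u' ^ e') (hinj ?_)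
  rw [← hz, map_pow, map_pow, hu', ← pow_mul, ← pow_mul]
  congr 1
  rw [mul_comm e', ← he']
  exact he.symm

end Kummer

section SecondLevel

variable {K : Type*} [Field K] {a b t θ : K} {m : ℕ}

local notation "ι" => algebraMap K[X] (RatFunc K)

lemma pow_ne_smul_omega (hb : b ≠ 0) (ht : t ≠ 0) (hθ : θ ≠ 0) (hm : 0 < m)
    (hodd : ∀ l : ℕ, 2 ≤ l → ∀ d : K, d ^ l ≠ θ / t) (htwo : ∀ d : K, d ^ 2 ≠ θ * b)
    {l : ℕ} (hl : l.Prime)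
    (g : MarkoffRing (RatFunc.C a) (RatFunc.C b) (RatFunc.C t * RatFunc.X ^ m : RatFunc K)) :
    g ^ l ≠ (RatFunc.C (θ / t ^ 2) * (RatFunc.X ^ m)⁻¹) • ω := by
  intro hg
  have hX : (RatFunc.X : RatFunc K) ≠ 0 := RatFunc.X_ne_zero
  have htC : (RatFunc.C t : RatFunc K) ≠ 0 := by simpa
  have hn : g.norm ^ l = RatFunc.C ((θ / t) ^ 2) := by
    rw [← map_pow, hg, quadratic_norm_smul, norm_omega]
    simp only [map_pow, map_div₀]
    field_simp
  rcases hl.eq_two_or_odd' with rfl | ⟨j, rfl⟩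
  · obtain ⟨ε, hε⟩ : ∃ ε : K, g.norm = RatFunc.C (ε * (θ / t)) := by
      rw [map_pow] at hn
      rcases sq_eq_sq_iff_eq_or_eq_neg.1 hn with h | h
      · exact ⟨1, by simpa using h⟩
      · exact ⟨-1, by simpa using h⟩
    have htr := trace_sq g
    rw [hg, map_smul, QuadraticAlgebra.trace_omega, smul_eq_mul, hε] at htr
    have hpoly : g.trace ^ 2 * RatFunc.X ^ m =
        ι (C (θ * a) * (X ^ m) ^ 2 + C (2 * ε * (θ / t)) * X ^ m + C (θ * b / t ^ 2)) := by
      rw [htr]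
      have hC : (RatFunc.C 2 : RatFunc K) = 2 := map_ofNat _ 2
      simp only [map_add, map_mul, map_pow, RatFunc.algebraMap_C, RatFunc.algebraMap_X, map_div₀,
        hC]
      field_simp
      ring
    obtain ⟨d, hd⟩ := exists_pow_eq_trailingCoeff hpoly
    have hc : θ * b / t ^ 2 ≠ 0 := by positivity
    have hc0 : (C (θ * a) * (X ^ m) ^ 2 + C (2 * ε * (θ / t)) * X ^ m + C (θ * b / t ^ 2)).coeff 0
        = θ * b / t ^ 2 := by
      simp [coeff_zero_eq_eval_zero, hm.ne']
    rw [trailingCoeff_eq_coeff_zero (hc0.trans_ne hc), hc0] at hd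
    refine htwo (d * t) ?_
    rw [mul_pow, hd]
    field_simp
  · obtain ⟨d, hd⟩ := exists_pow_eq_of_pow_eq_C hn
    have hu : θ / t ≠ 0 := div_ne_zero hθ ht
    refine hodd (2 * j + 1) hl.two_le (d ^ (j + 1) / (θ / t)) ?_
    rw [div_pow, ← pow_mul, mul_comm (j + 1), pow_mul, hd, ← pow_mul, div_eq_iff (by positivity)]
    ring

end SecondLevel

section Circulant

variable {A A' : Type*} [CommRing A] [CommRing A']

/-- The matrix of multiplication by `μ * ∑ l < D, f l * z ^ l` in the powers of `z`, cleared of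
denominators, where `μ * z ^ D = S`. -/
def twistedCirculant (D : ℕ) (μ S : A) (f : ℕ → A) : Matrix (Fin D) (Fin D) A :=
  Matrix.of fun i j => if i ≤ j then μ * f (j - i) else S * f (D + j - i)

lemma twistedCirculant_mul_pow {D : ℕ} {μ S z : A} (hz : μ * z ^ D = S) (f : ℕ → A) (i : Fin D) :
    ∑ j, twistedCirculant D μ S f i j * z ^ (j : ℕ) =
      μ * z ^ (i : ℕ) * ∑ l ∈ Finset.range D, f l * z ^ l := by
  obtain ⟨i, hi⟩ := i
  have h := Fin.sum_univ_eq_sum_range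
    (fun j => (if i ≤ j then μ * f (j - i) else S * f (D + j - i)) * z ^ j) D
  simp only [twistedCirculant, Matrix.of_apply, Fin.le_def]
  rw [h]
  obtain ⟨n, rfl⟩ := Nat.exists_eq_add_of_le hi.le
  rw [Finset.sum_range_add, add_comm i n, Finset.sum_range_add, mul_add, add_comm]
  congr 1
  · rw [Finset.mul_sum]
    refine Finset.sum_congr rfl fun x _ => ?_
    rw [if_pos (by lia), add_tsub_cancel_left, pow_add]
    ring
  · rw [Finset.mul_sum]
    refine Finset.sum_congr rfl fun x hx => ?_
    have hx := Finset.mem_range.1 hx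
    rw [if_neg (by lia), show n + i + x - i = n + x by lia, ← hz]
    ring

lemma map_twistedCirculant (φ : A →+* A') (D : ℕ) (μ S : A) (f : ℕ → A) :
    φ.mapMatrix (twistedCirculant D μ S f) = twistedCirculant D (φ μ) (φ S) (fun l => φ (f l)) := by
  ext i j
  simp only [twistedCirculant, RingHom.mapMatrix_apply, Matrix.map_apply, Matrix.of_apply]
  split_ifs <;> simp

lemma det_twistedCirculant_eq_zero {E : Type*} [Field E] {D : ℕ} (hD : 0 < D) {μ S z : E}
    (hz : μ * z ^ D = S) {f : ℕ → E} (hf : ∑ l ∈ Finset.range D, f l * z ^ l = 0) :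
    (twistedCirculant D μ S f).det = 0 := by
  rw [← Matrix.exists_mulVec_eq_zero_iff]
  refine ⟨fun j => z ^ (j : ℕ), fun h => ?_, ?_⟩
  · simpa using congrFun h ⟨0, hD⟩
  · ext i
    simpa [hf, Matrix.mulVec, dotProduct] using twistedCirculant_mul_pow hz f i

lemma det_twistedCirculant_ne_zero {L : Type*} [Field L] {D : ℕ} (hD : 0 < D) {ζ : L}
    (hζ : IsPrimitiveRoot ζ D) {μ S : L} (hμ : μ ≠ 0) (hS : S ≠ 0)
    (hs : ∀ l : ℕ, l.Prime → ∀ g : L, g ^ l ≠ S / μ) {f : ℕ → L} {j : ℕ} (hj : j < D)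
    (hfj : f j ≠ 0) : (twistedCirculant D μ S f).det ≠ 0 := by
  intro h0
  obtain ⟨v, hv, hvM⟩ := Matrix.exists_vecMul_eq_zero_iff.2 h0
  let ι := algebraMap L (AlgebraicClosure L)
  obtain ⟨z, hz⟩ := IsAlgClosed.exists_pow_nat_eq (ι (S / μ)) hD
  have hz' : ι μ * z ^ D = ι S := by
    rw [hz, ← map_mul, mul_div_cancel₀ _ hμ]
  have hz0 : z ≠ 0 := by
    rintro rfl
    rw [zero_pow hD.ne', eq_comm, map_eq_zero] at hz
    exact div_ne_zero hS hμ hz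
  have key : (∑ i : Fin D, ι (v i) * z ^ (i : ℕ)) *
      (ι μ * ∑ l ∈ Finset.range D, ι (f l) * z ^ l) = 0 := by
    have h1 :
        ∑ j : Fin D, ι ((Matrix.vecMul v (twistedCirculant D μ S f)) j) * z ^ (j : ℕ) = 0 := by
      simp [hvM]
    rw [← h1, Finset.sum_mul]
    simp only [Matrix.vecMul, dotProduct, map_sum, map_mul, Finset.sum_mul]
    rw [Finset.sum_comm]
    refine Finset.sum_congr rfl fun i _ => ?_
    have h2 := twistedCirculant_mul_pow hz' (fun l => ι (f l)) i
    rw [← map_twistedCirculant] at h2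
    simp only [RingHom.mapMatrix_apply, Matrix.map_apply] at h2
    simp only [mul_assoc, ← Finset.mul_sum] at h2 ⊢
    rw [h2]
    ring
  rcases mul_eq_zero.1 key with h | h
  · apply hv
    funext i
    have h2 := kummer_linearIndependent hD hζ (div_ne_zero hS hμ) hs hz
      (f := fun j => if hj : j < D then v ⟨j, hj⟩ else 0) ?_ i.2
    · simpa using h2
    · rw [← h, ← Fin.sum_univ_eq_sum_range
        (fun j => algebraMap L (AlgebraicClosure L) (if hj : j < D then v ⟨j, hj⟩ else 0) * z ^ j)]
      simp [ι]
  · rcases mul_eq_zero.1 h with h | h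
    · exact hμ (by simpa [ι] using h)
    · exact hfj (kummer_linearIndependent hD hζ (div_ne_zero hS hμ) hs hz h hj)

end Circulant

namespace MarkoffRing

variable {A E : Type*} [CommRing A] [CommRing E] {a b τ : A}

/-- The ring homomorphism from `A[ω]` extending `f` and sending `ω` to `w`. -/
def lift (f : A →+* E) (w : E) (h : w * w = -(f τ ^ 2) + (f a * f τ ^ 2 + f b) * w) :
    MarkoffRing a b τ →+* E where
  toFun x := f x.re + f x.im * w
  map_one' := by simp
  map_zero' := by simp
  map_add' x y := by simp; ring
  map_mul' x y := by
    simp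
    linear_combination -(f x.im * f y.im) * h

lemma lift_apply (f : A →+* E) (w : E) (h : w * w = -(f τ ^ 2) + (f a * f τ ^ 2 + f b) * w)
    (x : MarkoffRing a b τ) : lift f w h x = f x.re + f x.im * w := rfl

/-- The map induced on Markoff rings by a ring homomorphism. -/
def map (f : A →+* E) {a' b' τ' : E} (ha : f a = a') (hb : f b = b') (hτ : f τ = τ') :
    MarkoffRing a b τ →+* MarkoffRing a' b' τ' where
  toFun x := ⟨f x.re, f x.im⟩
  map_one' := by ext1 <;> simp
  map_zero' := by ext1 <;> simp
  map_add' x y := by ext1 <;> simp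
  map_mul' x y := by subst ha hb hτ; ext1 <;> simp

variable (f : A →+* E) {a' b' τ' : E} (ha : f a = a') (hb : f b = b') (hτ : f τ = τ')

@[simp] lemma re_map (x : MarkoffRing a b τ) : (map f ha hb hτ x).re = f x.re := rfl

@[simp] lemma im_map (x : MarkoffRing a b τ) : (map f ha hb hτ x).im = f x.im := rfl

lemma map_injective (hf : Function.Injective f) : Function.Injective (map f ha hb hτ) := by
  intro x y h
  ext1
  · exact hf (by simpa using congrArg QuadraticAlgebra.re h)
  · exact hf (by simpa using congrArg QuadraticAlgebra.im h)

end MarkoffRing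

/-- The ring `B[W][y^p]`, where `y^p` is the solution of the Markoff relation over `t W^m`. -/
abbrev FrobeniusRing {B : Type*} [CommRing B] (a b t : B) (m : ℕ) : Type _ :=
  MarkoffRing (C a) (C b) (C t * X ^ m : B[X])

lemma norm_det_twistedCirculant_ne_zero {B K : Type*} [CommRing B] [Field K] {ψ : B →+* K}
    (hψ : Function.Injective ψ) {a b t θ : B} {m D : ℕ} (hm : 0 < m) (hD : 0 < D) (ha : a ≠ 0)
    (hb : b ≠ 0) (ht : t ≠ 0) (hθ : θ ≠ 0) (hab : a * b ≠ 1)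
    (hodd : ∀ l : ℕ, 2 ≤ l → ∀ d : K, d ^ l ≠ ψ θ / ψ t) (htwo : ∀ d : K, d ^ 2 ≠ ψ θ * ψ b)
    {ζ : K} (hζ : IsPrimitiveRoot ζ D) {μ S : FrobeniusRing a b t m} (hμ : μ = ⟨C t ^ 2 * X ^ m, 0⟩)
    (hS : S = ⟨0, C θ⟩) (G : ℕ → B[X]) {j : ℕ} (hj : j < 2 * D) (hG : G j ≠ 0) :
    (twistedCirculant D μ S fun l => μ * algebraMap _ _ (G l) +
      S * algebraMap _ _ (G (l + D))).det.norm ≠ 0 := by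
  have hne : ∀ {x : B}, x ≠ 0 → ψ x ≠ 0 := fun h => (map_ne_zero_iff ψ hψ).2 h
  have hab' : ψ a * ψ b ≠ 1 := by
    rw [← map_mul, ← map_one ψ]
    exact fun h => hab (hψ h)
  have : Fact (∀ r : RatFunc K, r ^ 2 ≠ -((RatFunc.C (ψ t) * RatFunc.X ^ m) ^ 2)
      + (RatFunc.C (ψ a) * (RatFunc.C (ψ t) * RatFunc.X ^ m) ^ 2 + RatFunc.C (ψ b)) * r) :=
    ⟨markoff_no_root (hne ha) (hne ht) hab' hm⟩
  let f : B[X] →+* RatFunc K := (algebraMap K[X] (RatFunc K)).comp (mapRingHom ψ)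
  have hf : Function.Injective f :=
    (IsFractionRing.injective K[X] (RatFunc K)).comp (map_injective ψ hψ)
  have hfC : ∀ x, f (C x) = RatFunc.C (ψ x) := fun x => by simp [f, RatFunc.algebraMap_C]
  have hfX : f X = RatFunc.X := by simp [f, RatFunc.algebraMap_X]
  let φ : FrobeniusRing a b t m →+* MarkoffRing (RatFunc.C (ψ a)) (RatFunc.C (ψ b))
      (RatFunc.C (ψ t) * RatFunc.X ^ m) :=
    MarkoffRing.map f (hfC a) (hfC b) (by rw [map_mul, map_pow, hfC, hfX])
  have hφ : Function.Injective φ := MarkoffRing.map_injective f _ _ _ hf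
  have hμ0 : μ ≠ 0 := by
    subst hμ
    intro h
    have h1 := congrArg f (congrArg QuadraticAlgebra.re h)
    simp only [map_mul, map_pow, hfC, hfX, QuadraticAlgebra.re_zero, map_zero] at h1
    have := hne ht
    simp [RatFunc.X_ne_zero, this] at h1
  have hS0 : S ≠ 0 := by
    subst hS
    intro h
    exact hθ (by simpa using congrArg QuadraticAlgebra.im h)
  have hdet : φ (twistedCirculant D μ S fun l => μ * algebraMap _ _ (G l) +
      S * algebraMap _ _ (G (l + D))).det ≠ 0 := by
    obtain ⟨l, hl, hGl⟩ : ∃ l < D, G l ≠ 0 ∨ G (l + D) ≠ 0 := by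
      rcases lt_or_ge j D with h | h
      · exact ⟨j, h, Or.inl hG⟩
      · exact ⟨j - D, by lia, Or.inr (by rwa [Nat.sub_add_cancel h])⟩
    rw [RingHom.map_det, map_twistedCirculant]
    have hζ' : IsPrimitiveRoot (algebraMap (RatFunc K) (MarkoffRing (RatFunc.C (ψ a))
        (RatFunc.C (ψ b)) (RatFunc.C (ψ t) * RatFunc.X ^ m)) (RatFunc.C ζ)) D :=
      (hζ.map_of_injective RatFunc.C_injective).map_of_injective
        (algebraMap (RatFunc K) _).injective
    refine det_twistedCirculant_ne_zero hD hζ' ((map_ne_zero_iff φ hφ).2 hμ0)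
      ((map_ne_zero_iff φ hφ).2 hS0) ?_ hl ?_
    · intro l hl g hg
      refine pow_ne_smul_omega (hne hb) (hne ht) (hne hθ) hm hodd htwo hl g ?_
      rw [hg, div_eq_iff ((map_ne_zero_iff φ hφ).2 hμ0)]
      have htC : RatFunc.C (ψ t) ≠ 0 := by simpa using hne ht
      have hX : (RatFunc.X : RatFunc K) ≠ 0 := RatFunc.X_ne_zero
      subst hμ hS
      ext1
      · simp [φ]
      · simp [φ, hfC, hfX]
        field_simp
    · rw [map_ne_zero_iff φ hφ]
      intro h0
      have hre := congrArg f (congrArg QuadraticAlgebra.re h0)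
      have him := congrArg f (congrArg QuadraticAlgebra.im h0)
      subst hμ hS
      simp [hfC, hfX, hne ht, hne hθ, RatFunc.X_ne_zero, map_eq_zero_iff f hf] at hre him
      tauto
  have hnorm : ∀ x, (φ x).norm = f x.norm := fun x => by
    simp [QuadraticAlgebra.norm_def, φ, hfC, hfX]
  intro h0
  have h1 := QuadraticAlgebra.algebraMap_norm_eq_mul_star (φ (twistedCirculant D μ S fun l =>
    μ * algebraMap _ _ (G l) + S * algebraMap _ _ (G (l + D))).det)
  rw [hnorm, h0, map_zero, map_zero, eq_comm, mul_eq_zero, star_eq_zero, or_self] at h1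
  exact hdet h1

namespace MarkoffCurve

variable {k : Type*} [Field k] {a b : k}

lemma PoleLE.add {n : ℕ} {f g : MarkoffCurve a b} (hf : PoleLE n f) (hg : PoleLE n g) :
    PoleLE n (f + g) :=
  ⟨natDegree_add_le_of_degree_le hf.1 hg.1, by
    rw [QuadraticAlgebra.im_add, mul_add]
    exact natDegree_add_le_of_degree_le hf.2 hg.2⟩

lemma PoleLE.neg {n : ℕ} {f : MarkoffCurve a b} (hf : PoleLE n f) : PoleLE n (-f) :=
  ⟨by simpa using hf.1, by simpa using hf.2⟩

lemma poleLE_zero (n : ℕ) : PoleLE n (0 : MarkoffCurve a b) := by simp [PoleLE]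

lemma poleLE_algebraMap (c : k) : PoleLE 0 (algebraMap k (MarkoffCurve a b) c) := by
  simp [PoleLE, IsScalarTower.algebraMap_apply k k[X] (MarkoffCurve a b)]

/-- All coefficients of `P` have bounded pole order. -/
def CoeffPoleLE (n : ℕ) (P : (MarkoffCurve a b)[X]) : Prop := ∀ l, PoleLE n (P.coeff l)

lemma CoeffPoleLE.mono {n m : ℕ} (h : n ≤ m) {P : (MarkoffCurve a b)[X]} (hP : CoeffPoleLE n P) :
    CoeffPoleLE m P := fun l => (hP l).mono h

lemma CoeffPoleLE.add {n : ℕ} {P Q : (MarkoffCurve a b)[X]} (hP : CoeffPoleLE n P)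
    (hQ : CoeffPoleLE n Q) : CoeffPoleLE n (P + Q) := fun l => by
  rw [coeff_add]; exact (hP l).add (hQ l)

lemma CoeffPoleLE.neg {n : ℕ} {P : (MarkoffCurve a b)[X]} (hP : CoeffPoleLE n P) :
    CoeffPoleLE n (-P) := fun l => by
  rw [coeff_neg]; exact (hP l).neg

lemma CoeffPoleLE.mul {n m : ℕ} {P Q : (MarkoffCurve a b)[X]} (hP : CoeffPoleLE n P)
    (hQ : CoeffPoleLE m Q) : CoeffPoleLE (n + m) (P * Q) := fun l => by
  rw [coeff_mul]; exact PoleLE.sum _ fun i _ => (hP i.1).mul (hQ i.2)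

lemma coeffPoleLE_C {n : ℕ} {f : MarkoffCurve a b} (hf : PoleLE n f) : CoeffPoleLE n (C f) := by
  intro l
  rw [coeff_C]
  split_ifs
  exacts [hf, poleLE_zero n]

lemma coeffPoleLE_X_pow (m : ℕ) : CoeffPoleLE 0 (X ^ m : (MarkoffCurve a b)[X]) := by
  intro l
  rw [coeff_X_pow]
  split_ifs
  · exact map_one (algebraMap k (MarkoffCurve a b)) ▸ poleLE_algebraMap 1
  · exact poleLE_zero 0

/-- The Frobenius ring over the curve: `W` stands for `t ^ h` and `ω` for the `p`-th power. -/
abbrev Frob (a b : k) (m : ℕ) : Type _ :=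
  FrobeniusRing (algebraMap k (MarkoffCurve a b) a) (algebraMap k (MarkoffCurve a b) b) (crd a b) m

/-- The coefficients of an element of the Frobenius ring have bounded pole order. -/
def FrobPoleLE {m : ℕ} (n : ℕ) (f : Frob a b m) : Prop :=
  CoeffPoleLE n f.re ∧ CoeffPoleLE n f.im

variable {m : ℕ}

lemma coeffPoleLE_sq : CoeffPoleLE 2 ((C (crd a b) * X ^ m) ^ 2 : (MarkoffCurve a b)[X]) := by
  rw [sq]
  exact ((coeffPoleLE_C poleLE_crd).mul (coeffPoleLE_X_pow m)).mul
    ((coeffPoleLE_C poleLE_crd).mul (coeffPoleLE_X_pow m))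

lemma coeffPoleLE_linear : CoeffPoleLE 2 (C (algebraMap k (MarkoffCurve a b) a) *
    (C (crd a b) * X ^ m) ^ 2 + C (algebraMap k (MarkoffCurve a b) b)) :=
  (((coeffPoleLE_C (poleLE_algebraMap a)).mul coeffPoleLE_sq).mono (by lia)).add
    ((coeffPoleLE_C (poleLE_algebraMap b)).mono (by lia))

lemma FrobPoleLE.mul {n n' : ℕ} {f g : Frob a b m} (hf : FrobPoleLE n f) (hg : FrobPoleLE n' g) :
    FrobPoleLE (n + n' + 2) (f * g) := by
  constructor
  · rw [QuadraticAlgebra.re_mul]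
    exact ((hf.1.mul hg.1).mono (by lia)).add
      (((coeffPoleLE_sq.neg.mul hf.2).mul hg.2).mono (by lia))
  · rw [QuadraticAlgebra.im_mul]
    exact (((hf.1.mul hg.2).mono (by lia)).add ((hf.2.mul hg.1).mono (by lia))).add
      (((coeffPoleLE_linear.mul hf.2).mul hg.2).mono (by lia))

lemma FrobPoleLE.mono {n n' : ℕ} (h : n ≤ n') {f : Frob a b m} (hf : FrobPoleLE n f) :
    FrobPoleLE n' f := ⟨hf.1.mono h, hf.2.mono h⟩

lemma FrobPoleLE.add {n : ℕ} {f g : Frob a b m} (hf : FrobPoleLE n f) (hg : FrobPoleLE n g) :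
    FrobPoleLE n (f + g) := ⟨hf.1.add hg.1, hf.2.add hg.2⟩

lemma FrobPoleLE.neg {n : ℕ} {f : Frob a b m} (hf : FrobPoleLE n f) :
    FrobPoleLE n (-f) := ⟨hf.1.neg, hf.2.neg⟩

lemma frobPoleLE_algebraMap {n : ℕ} {P : (MarkoffCurve a b)[X]} (hP : CoeffPoleLE n P) :
    FrobPoleLE n (algebraMap _ (Frob a b m) P) := by
  constructor
  · simpa using hP
  · intro l; simpa using poleLE_zero n

lemma FrobPoleLE.det {n D : ℕ} {M : Matrix (Fin D) (Fin D) (Frob a b m)}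
    (hM : ∀ i j, FrobPoleLE n (M i j)) : FrobPoleLE (D * (n + 2)) M.det := by
  have h1 : ∀ (s : Finset (Fin D)) (σ : Equiv.Perm (Fin D)),
      FrobPoleLE (s.card * (n + 2)) (∏ i ∈ s, M (σ i) i) := by
    intro s σ
    induction s using Finset.induction_on with
    | empty =>
      have : CoeffPoleLE 0 (1 : (MarkoffCurve a b)[X]) := by simpa using coeffPoleLE_X_pow 0
      simpa using frobPoleLE_algebraMap this
    | insert i s hi ih =>
      rw [Finset.prod_insert hi, Finset.card_insert_of_notMem hi]
      exact ((hM _ _).mul ih).mono (by lia)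
  have h2 : ∀ (s : Finset (Equiv.Perm (Fin D))),
      FrobPoleLE (D * (n + 2)) (∑ σ ∈ s, Equiv.Perm.sign σ • ∏ i, M (σ i) i) := by
    intro s
    induction s using Finset.induction_on with
    | empty =>
      have : CoeffPoleLE (D * (n + 2)) (0 : (MarkoffCurve a b)[X]) := fun l => by
        simpa using poleLE_zero _
      simpa using frobPoleLE_algebraMap this
    | insert σ s hi ih =>
      rw [Finset.sum_insert hi]
      refine FrobPoleLE.add ?_ ih
      have h3 := h1 Finset.univ σ
      rw [Finset.card_univ, Fintype.card_fin] at h3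
      rcases Int.units_eq_one_or (Equiv.Perm.sign σ) with h | h
      · rwa [h, one_smul]
      · rw [h, Units.neg_smul, one_smul]
        exact h3.neg
  rw [Matrix.det_apply]
  exact h2 _

lemma FrobPoleLE.norm {n : ℕ} {f : Frob a b m} (hf : FrobPoleLE n f) :
    CoeffPoleLE (2 * n + 2) f.norm := by
  rw [QuadraticAlgebra.norm_def]
  simp only [sub_eq_add_neg]
  exact (((hf.1.mul hf.1).mono (by lia)).add (((coeffPoleLE_linear.mul hf.1).mul hf.2).mono
    (by lia))).add (((coeffPoleLE_sq.neg.mul hf.2).mul hf.2).mono (by lia)).neg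

lemma eq_zero_of_sum_X_pow_mul {h n : ℕ} {P : ℕ → k[X]} (hP : ∀ l, (P l).natDegree < h)
    (h0 : ∑ l ∈ Finset.range n, X ^ (h * l) * P l = 0) {l : ℕ} (hl : l < n) : P l = 0 := by
  ext r
  rcases lt_or_ge r h with hr | hr
  · have h1 := congrArg (fun q => coeff q (r + h * l)) h0
    simp only [finsetSum_coeff, coeff_zero] at h1
    rw [Finset.sum_eq_single l] at h1
    · rwa [coeff_X_pow_mul] at h1
    · intro i _ hi
      rw [coeff_X_pow_mul']
      split_ifs with hle
      · refine coeff_eq_zero_of_natDegree_lt ((hP i).trans_le ?_)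
        have h2 : i < l := by
          rcases lt_or_gt_of_ne hi with h' | h'
          · exact h'
          · have : h * (l + 1) ≤ h * i := Nat.mul_le_mul_left _ h'
            lia
        have : h * (i + 1) ≤ h * l := Nat.mul_le_mul_left _ h2
        lia
      · rfl
    · intro h'
      simp [hl] at h'
  · rw [coeff_zero]
    exact coeff_eq_zero_of_natDegree_lt ((hP l).trans_le hr)

lemma eq_zero_of_eval_crd_pow {h n : ℕ} {N : (MarkoffCurve a b)[X]} (hN : CoeffPoleLE n N)
    (hn : n < h) (h0 : N.eval (crd a b ^ h) = 0) : N = 0 := by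
  have hc : ∀ (l : ℕ) (x : MarkoffCurve a b),
      x * (crd a b ^ h) ^ l = (X ^ (h * l) : k[X]) • x := by
    intro l x
    rw [← pow_mul, mul_comm, Algebra.smul_def, map_pow]
    rfl
  rw [eval_eq_sum_range] at h0
  simp only [hc] at h0
  have h1 : ∀ l < N.natDegree + 1, (N.coeff l).re = 0 := by
    refine fun l => eq_zero_of_sum_X_pow_mul (h := h) (P := fun l => (N.coeff l).re)
      (fun l => ((hN l).1).trans_lt hn) ?_
    simpa using congrArg (QuadraticAlgebra.reₗ _ _) h0
  have h2 : ∀ l < N.natDegree + 1, (N.coeff l).im = 0 := by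
    refine fun l => eq_zero_of_sum_X_pow_mul (h := h) (P := fun l => (N.coeff l).im)
      (fun l => (natDegree_le_of_X_sq_mul (hN l).2).trans_lt hn) ?_
    simpa using congrArg (QuadraticAlgebra.imₗ _ _) h0
  ext1 l
  rcases lt_or_ge l (N.natDegree + 1) with hl | hl
  · rw [coeff_zero]
    ext1
    exacts [h1 l hl, h2 l hl]
  · rw [coeff_eq_zero_of_natDegree_lt (by lia), coeff_zero]

end MarkoffCurve

section Sums

lemma sum_mul_div_pow_eq_zero {E : Type*} [Field E] {t w : E} (ht : t ≠ 0) {c : ℕ → E} {D e : ℕ}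
    (h : ∑ j ∈ Finset.range (2 * D), t ^ (e * (2 * D - 1 - j)) * w ^ (e * j) * c j = 0) :
    ∑ j ∈ Finset.range (D + D), c j * (w ^ e / t ^ e) ^ j = 0 := by
  have h1 :
      (∑ j ∈ Finset.range (D + D), c j * (w ^ e / t ^ e) ^ j) * t ^ (e * (2 * D - 1)) = 0 := by
    rw [← h, ← two_mul, Finset.sum_mul]
    refine Finset.sum_congr rfl fun j hj => ?_
    have hj := Finset.mem_range.1 hj
    have h5 : t ^ (e * (2 * D - 1)) = t ^ (e * (2 * D - 1 - j)) * t ^ (e * j) := by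
      rw [← pow_add, ← mul_add]
      congr 2
      lia
    rw [h5, div_pow, ← pow_mul, ← pow_mul]
    field_simp
  exact (mul_eq_zero.1 h1).resolve_right (pow_ne_zero _ ht)

lemma sum_fold_eq_zero {E : Type*} [CommRing E] {μ S z : E} {D : ℕ} (hz : μ * z ^ D = S)
    {c : ℕ → E} (h : ∑ j ∈ Finset.range (D + D), c j * z ^ j = 0) :
    ∑ l ∈ Finset.range D, (μ * c l + S * c (l + D)) * z ^ l = 0 := by
  rw [Finset.sum_range_add] at h
  rw [← mul_zero μ, ← h, mul_add, Finset.mul_sum, Finset.mul_sum, ← Finset.sum_add_distrib]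
  refine Finset.sum_congr rfl fun l _ => ?_
  rw [← hz, add_comm l D, pow_add]
  ring

lemma markoff_frobenius {E : Type*} [CommRing E] (p : ℕ) [Fact p.Prime] [CharP E p] {a b t w : E}
    (ha : a ^ p = a) (hb : b ^ p = b) (h : w * w = -(t ^ 2) + (a * t ^ 2 + b) * w) :
    w ^ p * w ^ p = -((t ^ p) ^ 2) + (a * (t ^ p) ^ 2 + b) * w ^ p := by
  have := congrArg (frobenius E p) h
  simp only [map_mul, map_add, map_neg, map_pow] at this
  simpa only [frobenius_def, ha, hb] using this

end Sums

namespace MarkoffCurve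

variable {k : Type*} [Field k] {a b : k}

/-- The embedding of the coordinate ring into the function field. -/
noncomputable def toField (a b : k) : MarkoffCurve a b →+* MarkoffField a b :=
  MarkoffRing.map (algebraMap k[X] (RatFunc k)) (RatFunc.algebraMap_C a) (RatFunc.algebraMap_C b)
    RatFunc.algebraMap_X

lemma toField_injective : Function.Injective (toField a b) :=
  MarkoffRing.map_injective _ _ _ _ (IsFractionRing.injective k[X] (RatFunc k))

lemma fact_markoffField (ha : a ≠ 0) (hab : a * b ≠ 1) : Fact (∀ r : RatFunc k, r ^ 2 ≠
    -(RatFunc.X ^ 2) + (RatFunc.C a * RatFunc.X ^ 2 + RatFunc.C b) * r) :=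
  ⟨fun r => by simpa using markoff_no_root ha one_ne_zero hab one_pos r⟩

lemma toField_omega : toField a b ω = ω := by
  ext1 <;> simp [toField]

lemma toField_star (f : MarkoffCurve a b) : toField a b (star f) = star (toField a b f) := by
  ext1 <;> simp [toField, RatFunc.algebraMap_C, RatFunc.algebraMap_X]

lemma toField_crd : toField a b (crd a b) = algebraMap (RatFunc k) _ RatFunc.X := by
  ext1
  · exact RatFunc.algebraMap_X
  · exact map_zero (algebraMap k[X] (RatFunc k))

lemma toField_algebraMap (c : k) : toField a b (algebraMap k (MarkoffCurve a b) c) =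
    algebraMap (RatFunc k) _ (RatFunc.C c) := by
  rw [IsScalarTower.algebraMap_apply k k[X] (MarkoffCurve a b)]
  ext1 <;> simp [toField, RatFunc.algebraMap_C]

lemma mul_star_omega : (ω : MarkoffCurve a b) * star ω = crd a b ^ 2 := by
  ext1 <;> simp [crd, sq]

lemma crd_ne_zero : crd a b ≠ 0 := fun h => by
  simpa [crd] using congrArg QuadraticAlgebra.re h

lemma omega_ne_zero : (ω : MarkoffCurve a b) ≠ 0 := fun h => by
  simpa using congrArg QuadraticAlgebra.im h

/-- The element `t² W^m` of the Frobenius ring. -/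
noncomputable def frobDenom (a b : k) (m : ℕ) : Frob a b m := ⟨C (crd a b) ^ 2 * X ^ m, 0⟩

/-- The element `ω θ` of the Frobenius ring. -/
noncomputable def frobNum (m : ℕ) (θ : MarkoffCurve a b) : Frob a b m := ⟨0, C θ⟩

/-- The determinant of multiplication by `∑ j < 2 * D, G j * z ^ j` in the powers of a `D`-th
root `z` of `frobNum m θ / frobDenom a b m`. -/
noncomputable def frobDet (m D : ℕ) (θ : MarkoffCurve a b) (G : ℕ → (MarkoffCurve a b)[X]) :
    Frob a b m :=
  (twistedCirculant D (frobDenom a b m) (frobNum m θ) fun l =>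
    frobDenom a b m * algebraMap _ _ (G l) + frobNum m θ * algebraMap _ _ (G (l + D))).det

lemma norm_frobDet_ne_zero (ha : a ≠ 0) (hb : b ≠ 0) (hab : a * b ≠ 1) {m D : ℕ} (hm : 0 < m)
    (hD : 0 < D) {θ : MarkoffCurve a b} (hθ0 : θ ≠ 0)
    (hodd : ∀ l : ℕ, 2 ≤ l → ∀ d : MarkoffField a b,
      d ^ l * toField a b (crd a b) ≠ toField a b θ)
    (htwo : ∀ d : MarkoffField a b,
      d ^ 2 ≠ toField a b θ * toField a b (algebraMap k _ b))
    {ζ : k} (hζ : IsPrimitiveRoot ζ D) {G : ℕ → (MarkoffCurve a b)[X]} {j : ℕ} (hj : j < 2 * D)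
    (hG : G j ≠ 0) : (frobDet m D θ G).norm ≠ 0 := by
  have := fact_markoffField ha hab
  have ht : toField a b (crd a b) ≠ 0 := (map_ne_zero_iff _ toField_injective).2 crd_ne_zero
  have hinj : Function.Injective (algebraMap k (MarkoffCurve a b)) :=
    (algebraMap k (MarkoffCurve a b)).injective
  have hab' : algebraMap k (MarkoffCurve a b) a * algebraMap k (MarkoffCurve a b) b ≠ 1 := by
    rw [← map_mul, ← map_one (algebraMap k (MarkoffCurve a b))]
    exact fun h => hab (hinj h)
  have hodd' : ∀ l : ℕ, 2 ≤ l → ∀ d : MarkoffField a b,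
      d ^ l ≠ toField a b θ / toField a b (crd a b) := fun l hl d hd =>
    hodd l hl d ((eq_div_iff ht).1 hd)
  exact norm_det_twistedCirculant_ne_zero toField_injective hm hD ((map_ne_zero_iff _ hinj).2 ha)
      ((map_ne_zero_iff _ hinj).2 hb) crd_ne_zero hθ0 hab' hodd' htwo
      (hζ.map_of_injective (algebraMap k (MarkoffField a b)).injective) rfl rfl G hj hG

lemma frobPoleLE_frobDenom {m : ℕ} : FrobPoleLE 2 (frobDenom a b m) := by
  constructor
  · rw [frobDenom]
    simpa only [sq] using ((coeffPoleLE_C poleLE_crd).mul (coeffPoleLE_C poleLE_crd)).mul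
      (coeffPoleLE_X_pow m)
  · rw [frobDenom]
    intro l
    rw [coeff_zero]
    exact poleLE_zero 2

lemma frobPoleLE_frobNum {m : ℕ} {θ : MarkoffCurve a b} (hθ : PoleLE 2 θ) :
    FrobPoleLE 2 (frobNum m θ) := by
  constructor
  · rw [frobNum]
    intro l
    rw [coeff_zero]
    exact poleLE_zero 2
  · rw [frobNum]
    exact coeffPoleLE_C hθ

lemma frobPoleLE_frobDet {m D d : ℕ} {θ : MarkoffCurve a b} (hθ : PoleLE 2 θ)
    {G : ℕ → (MarkoffCurve a b)[X]} (hG : ∀ j, CoeffPoleLE (d + 1) (G j)) :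
    FrobPoleLE (D * (d + 9 + 2)) (frobDet m D θ G) := by
  refine FrobPoleLE.det fun i j => ?_
  have hμ : FrobPoleLE 2 (frobDenom a b m) := frobPoleLE_frobDenom
  have hS : FrobPoleLE 2 (frobNum m θ) := frobPoleLE_frobNum hθ
  have hG' : ∀ l, FrobPoleLE (d + 1) (algebraMap _ (Frob a b m) (G l)) := fun l =>
    frobPoleLE_algebraMap (hG l)
  have hf := fun l => ((hμ.mul (hG' l)).mono (n' := d + 5) (by lia)).add
    ((hS.mul (hG' (l + D))).mono (by lia))
  simp only [twistedCirculant, Matrix.of_apply]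
  split_ifs
  · exact (hμ.mul (hf _)).mono (by lia)
  · exact (hS.mul (hf _)).mono (by lia)

lemma toField_frobenius (p : ℕ) [Fact p.Prime] [CharP k p] (ha : a ≠ 0) (hab : a * b ≠ 1)
    (hap : a ^ p = a) (hbp : b ^ p = b) :
    toField a b (ω ^ p) * toField a b (ω ^ p) = -(toField a b (crd a b ^ p) ^ 2) +
      (toField a b (algebraMap k _ a) * toField a b (crd a b ^ p) ^ 2 +
        toField a b (algebraMap k _ b)) * toField a b (ω ^ p) := by
  have := fact_markoffField ha hab
  have : CharP (MarkoffField a b) p :=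
    charP_of_injective_algebraMap (algebraMap k (MarkoffField a b)).injective p
  have h1 : (ω : MarkoffCurve a b) * ω = -(crd a b ^ 2) +
      (algebraMap k _ a * crd a b ^ 2 + algebraMap k _ b) * ω := by
    rw [IsScalarTower.algebraMap_apply k k[X] (MarkoffCurve a b),
      IsScalarTower.algebraMap_apply k k[X] (MarkoffCurve a b)]
    ext1 <;> simp [crd, sq]
  have h2 := congrArg (toField a b) h1
  rw [map_mul, map_add, map_neg, map_pow, map_mul, map_add, map_mul, map_pow] at h2
  have hap' : toField a b (algebraMap k _ a) ^ p = toField a b (algebraMap k _ a) := by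
    rw [← map_pow, ← map_pow, hap]
  have hbp' : toField a b (algebraMap k _ b) ^ p = toField a b (algebraMap k _ b) := by
    rw [← map_pow, ← map_pow, hbp]
  rw [map_pow (toField a b) ω, map_pow (toField a b) (crd a b)]
  exact markoff_frobenius p hap' hbp' h2

lemma map_norm_frobDet_eq_zero {E : Type*} [Field E] {m D e : ℕ} (hD : 0 < D)
    {θ : MarkoffCurve a b} (χ : Frob a b m →+* E) {t w : E} (ht : t ≠ 0)
    (hz : χ (frobDenom a b m) * (w ^ e / t ^ e) ^ D = χ (frobNum m θ))
    {G : ℕ → (MarkoffCurve a b)[X]} (hG : ∑ j ∈ Finset.range (2 * D),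
      t ^ (e * (2 * D - 1 - j)) * w ^ (e * j) * χ (algebraMap _ _ (G j)) = 0) :
    χ (algebraMap _ _ (frobDet m D θ G).norm) = 0 := by
  have hdet : χ (frobDet m D θ G) = 0 := by
    rw [frobDet, RingHom.map_det, map_twistedCirculant]
    refine det_twistedCirculant_eq_zero hD hz ?_
    have h1 := sum_fold_eq_zero hz (sum_mul_div_pow_eq_zero ht hG)
    refine (Finset.sum_congr rfl fun l _ => ?_).trans h1
    rw [map_add, map_mul, map_mul]
  rw [QuadraticAlgebra.algebraMap_norm_eq_mul_star, map_mul, hdet, zero_mul]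

/-- Evaluation of the Frobenius ring at `W = t ^ h` and a given image `w` of `ω`. -/
lemma exists_evalFrob {E : Type*} [Field E] (f : MarkoffCurve a b →+* E) {h m : ℕ} {w t : E}
    (ht : t = f (crd a b * (crd a b ^ h) ^ m))
    (hw : w * w = -(t ^ 2) + (f (algebraMap k _ a) * t ^ 2 + f (algebraMap k _ b)) * w)
    (θ : MarkoffCurve a b) : ∃ χ : Frob a b m →+* E,
      (∀ P : (MarkoffCurve a b)[X], χ (algebraMap _ _ P) = f (P.eval (crd a b ^ h))) ∧
      χ (frobDenom a b m) = f (crd a b ^ 2 * (crd a b ^ h) ^ m) ∧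
      χ (frobNum m θ) = f θ * w := by
  obtain ⟨ev₁, hev₁⟩ : ∃ ev₁ : (MarkoffCurve a b)[X] →+* E,
      ∀ P, ev₁ P = f (P.eval (crd a b ^ h)) :=
    ⟨f.comp (evalRingHom (crd a b ^ h)), fun P => rfl⟩
  have hevC : ∀ x, ev₁ (C x) = f x := fun x => by rw [hev₁, eval_C]
  have hevτ : ev₁ (C (crd a b) * X ^ m) = t := by
    rw [hev₁, eval_mul, eval_C, eval_pow, eval_X, ht]
  refine ⟨MarkoffRing.lift ev₁ w (by rw [hevτ, hevC, hevC]; exact hw), fun P => ?_, ?_, ?_⟩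
  · rw [MarkoffRing.lift_apply, ← hev₁, QuadraticAlgebra.algebraMap_re,
      QuadraticAlgebra.algebraMap_im, map_zero, zero_mul, add_zero]
  · rw [MarkoffRing.lift_apply, frobDenom, hev₁, map_zero, zero_mul, add_zero, eval_mul, eval_pow,
      eval_C, eval_pow, eval_X]
  · rw [MarkoffRing.lift_apply, frobNum, hevC, map_zero, zero_add]

lemma eval_norm_frobDet (p : ℕ) [Fact p.Prime] [CharP k p] (ha : a ≠ 0)
    (hab : a * b ≠ 1) (hap : a ^ p = a) (hbp : b ^ p = b) {h m D e : ℕ} (hh : h * m + 1 = p)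
    (hD : 0 < D) {θ : MarkoffCurve a b}
    (hθe : crd a b ^ (p + 1) * ω ^ (e * D) = ω ^ p * θ * crd a b ^ (e * D))
    {G : ℕ → (MarkoffCurve a b)[X]}
    (hG : ∑ j ∈ Finset.range (2 * D),
      crd a b ^ (e * (2 * D - 1 - j)) * ω ^ (e * j) * (G j).eval (crd a b ^ h) = 0) :
    (frobDet m D θ G).norm.eval (crd a b ^ h) = 0 := by
  have := fact_markoffField ha hab
  have hψ : Function.Injective (toField a b) := toField_injective
  have ht : toField a b (crd a b) ≠ 0 := (map_ne_zero_iff _ hψ).2 crd_ne_zero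
  have ht1 : crd a b * (crd a b ^ h) ^ m = crd a b ^ p := by
    rw [← pow_mul, ← hh, pow_succ' (crd a b)]
  have ht2 : crd a b ^ 2 * (crd a b ^ h) ^ m = crd a b ^ (p + 1) := by
    rw [sq (crd a b), mul_assoc, ht1, pow_succ' (crd a b)]
  obtain ⟨χ, hχ, hχμ, hχS⟩ := exists_evalFrob (toField a b) (congrArg _ ht1).symm
    (toField_frobenius p ha hab hap hbp) θ
  have hz : χ (frobDenom a b m) *
      (toField a b ω ^ e / toField a b (crd a b) ^ e) ^ D = χ (frobNum m θ) := by
    rw [hχμ, ht2, hχS, div_pow, ← mul_div_assoc, div_eq_iff (pow_ne_zero _ (pow_ne_zero _ ht)),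
      ← map_mul, ← pow_mul, ← pow_mul, ← map_pow, ← map_pow, ← map_mul, ← map_mul, hθe,
      mul_comm θ]
  have hG' : ∑ j ∈ Finset.range (2 * D), toField a b (crd a b) ^ (e * (2 * D - 1 - j)) *
      toField a b ω ^ (e * j) * χ (algebraMap _ _ (G j)) = 0 := by
    rw [← map_zero (toField a b), ← hG, map_sum]
    refine Finset.sum_congr rfl fun j _ => ?_
    rw [hχ, map_mul, map_mul, map_pow, map_pow]
  refine hψ ?_
  rw [← hχ, map_norm_frobDet_eq_zero hD χ ht hz hG', map_zero]

theorem sum_ne_zero_of_isPrimitiveRoot (p : ℕ) [Fact p.Prime] [CharP k p] (ha : a ≠ 0)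
    (hb : b ≠ 0) (hab : a * b ≠ 1) (hap : a ^ p = a) (hbp : b ^ p = b) {h m D e : ℕ}
    (hh : h * m + 1 = p) (hm : 0 < m) (hD : 0 < D) {θ : MarkoffCurve a b} (hθ0 : θ ≠ 0)
    (hθ : PoleLE 2 θ)
    (hodd : ∀ l : ℕ, 2 ≤ l → ∀ d : MarkoffField a b,
      d ^ l * toField a b (crd a b) ≠ toField a b θ)
    (htwo : ∀ d : MarkoffField a b,
      d ^ 2 ≠ toField a b θ * toField a b (algebraMap k _ b))
    (hθe : crd a b ^ (p + 1) * ω ^ (e * D) = ω ^ p * θ * crd a b ^ (e * D))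
    {ζ : k} (hζ : IsPrimitiveRoot ζ D) {d I : ℕ} {g : ℕ → ℕ → MarkoffCurve a b}
    (hg : ∀ i j, DegLT d (g i j)) (hdeg : 2 * D * (d + 12) < h) {i₀ j₀ : ℕ} (hi₀ : i₀ < I)
    (hj₀ : j₀ < 2 * D) (hg₀ : g i₀ j₀ ≠ 0) :
    ∑ i ∈ Finset.range I, ∑ j ∈ Finset.range (2 * D),
      crd a b ^ (h * i + e * (2 * D - 1 - j)) * ω ^ (e * j) * g i j ≠ 0 := by
  intro hF
  let G : ℕ → (MarkoffCurve a b)[X] := fun j => ∑ i ∈ Finset.range I, C (g i j) * X ^ i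
  have hG₀ : G j₀ ≠ 0 := fun h0 => hg₀ <| by
    have := congrArg (fun q => coeff q i₀) h0
    simpa [G, coeff_X_pow, hi₀] using this
  have hG : ∀ l, CoeffPoleLE (d + 1) (G l) := by
    intro l i
    simp only [G, finsetSum_coeff, coeff_C_mul, coeff_X_pow]
    refine PoleLE.sum _ fun i' _ => ?_
    split_ifs
    · simpa using (hg i' l).poleLE
    · simpa using poleLE_zero (d + 1)
  refine norm_frobDet_ne_zero ha hb hab hm hD hθ0 hodd htwo hζ hj₀ hG₀
    (eq_zero_of_eval_crd_pow (frobPoleLE_frobDet hθ hG).norm (h := h) (by nlinarith) ?_)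
  refine eval_norm_frobDet p ha hab hap hbp hh hD hθe (hF ▸ ?_)
  rw [Finset.sum_comm]
  refine Finset.sum_congr rfl fun j _ => ?_
  simp only [G, eval_finsetSum, eval_mul, eval_C, eval_pow, eval_X, Finset.mul_sum]
  refine Finset.sum_congr rfl fun i _ => ?_
  ring

end MarkoffCurve

namespace MarkoffCurve

variable {k : Type*} [Field k] {a b : k}

lemma star_omega_ne_zero : star (ω : MarkoffCurve a b) ≠ 0 := fun h => by
  simpa using congrArg QuadraticAlgebra.im h

lemma poleLE_star_omega : PoleLE 2 (star ω : MarkoffCurve a b) := by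
  refine ⟨?_, by simp⟩
  simp only [QuadraticAlgebra.re_star, QuadraticAlgebra.omega_re, QuadraticAlgebra.omega_im,
    zero_add, mul_one]
  compute_degree

lemma pow_mul_ne_omega (ha : a ≠ 0) {l : ℕ} (hl : 2 ≤ l) (d : MarkoffField a b) :
    d ^ l * algebraMap (RatFunc k) _ RatFunc.X ≠ ω := fun h => by
  have hX : (RatFunc.X : RatFunc k) ≠ 0 := RatFunc.X_ne_zero
  refine pow_ne_inv_X_smul_omega ha hl d ?_
  rw [← h, mul_comm (d ^ l), ← Algebra.smul_def, smul_smul, inv_mul_cancel₀ hX, one_smul]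

lemma sq_ne_omega_mul (hb : b ≠ 0) (hab : a * b ≠ 1) (h2 : (2 : k) ≠ 0) (d : MarkoffField a b) :
    d ^ 2 ≠ ω * algebraMap (RatFunc k) _ (RatFunc.C b) := fun h => by
  refine sq_ne_smul_omega hb hab h2 d ?_
  rw [h, mul_comm (ω : MarkoffField a b), Algebra.smul_def]

lemma star_algebraMap (r : RatFunc k) :
    star (algebraMap (RatFunc k) (MarkoffField a b) r) = algebraMap _ _ r := by
  ext1 <;> simp

/-- The elements of `⨁ crd ^ (h * i) * (ω ^ e / crd ^ e) ^ j` with small coefficients are nonzero,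
in the split case `e * D = p - 1` and in the nonsplit case `e * D = p + 1`. -/
theorem sum_ne_zero (p : ℕ) [Fact p.Prime] [CharP k p] (ha : a ≠ 0)
    (hb : b ≠ 0) (hab : a * b ≠ 1) (h2 : (2 : k) ≠ 0) (hap : a ^ p = a) (hbp : b ^ p = b)
    {h m D e : ℕ} (hh : h * m + 1 = p) (hm : 0 < m) (hD : 0 < D)
    (he : e * D = p + 1 ∨ e * D + 1 = p)
    {ζ : k} (hζ : IsPrimitiveRoot ζ D) {d I : ℕ} {g : ℕ → ℕ → MarkoffCurve a b}
    (hg : ∀ i j, DegLT d (g i j)) (hdeg : 2 * D * (d + 12) < h) {i₀ j₀ : ℕ} (hi₀ : i₀ < I)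
    (hj₀ : j₀ < 2 * D) (hg₀ : g i₀ j₀ ≠ 0) :
    ∑ i ∈ Finset.range I, ∑ j ∈ Finset.range (2 * D),
      crd a b ^ (h * i + e * (2 * D - 1 - j)) * ω ^ (e * j) * g i j ≠ 0 := by
  rcases he with he | he
  · refine sum_ne_zero_of_isPrimitiveRoot p ha hb hab hap hbp hh hm hD omega_ne_zero poleLE_omega
      (fun l hl d => ?_) (fun d => ?_) ?_ hζ hg hdeg hi₀ hj₀ hg₀
    · rw [toField_crd, toField_omega]
      exact pow_mul_ne_omega ha hl d
    · rw [toField_algebraMap, toField_omega]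
      exact sq_ne_omega_mul hb hab h2 d
    · rw [he, ← pow_succ (ω : MarkoffCurve a b), mul_comm]
  · refine sum_ne_zero_of_isPrimitiveRoot p ha hb hab hap hbp hh hm hD star_omega_ne_zero
      poleLE_star_omega (fun l hl d hd => ?_) (fun d hd => ?_) ?_ hζ hg hdeg hi₀ hj₀ hg₀
    · rw [toField_crd, toField_star, toField_omega] at hd
      have h1 := congrArg star hd
      rw [star_mul', star_pow, star_algebraMap, star_star] at h1
      exact pow_mul_ne_omega ha hl _ h1
    · rw [toField_algebraMap, toField_star, toField_omega] at hd
      have h1 := congrArg star hd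
      rw [star_mul', star_pow, star_algebraMap, star_star] at h1
      exact sq_ne_omega_mul hb hab h2 _ h1
    · generalize hq : e * D = q at he ⊢
      rw [← he, pow_succ (ω : MarkoffCurve a b), mul_assoc _ ω, mul_star_omega, pow_add (crd a b),
        pow_add (crd a b)]
      ring

end MarkoffCurve

namespace MarkoffCurve

variable {k : Type*} [Field k] {a b : k}

lemma norm_ne_zero (ha : a ≠ 0) (hab : a * b ≠ 1) {f : MarkoffCurve a b} (hf : f ≠ 0) :
    f.norm ≠ 0 := fun h => by
  have := fact_markoffField ha hab
  have h1 := congrArg (toField a b) (QuadraticAlgebra.algebraMap_norm_eq_mul_star f)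
  rw [h, map_zero, map_zero, map_mul, toField_star] at h1
  have h2 := (map_ne_zero_iff _ toField_injective).2 hf
  rcases mul_eq_zero.1 h1.symm with h3 | h3
  · exact h2 h3
  · exact h2 (by rw [← star_star (toField a b f), h3, star_zero])

lemma eq_or_eq_conj {t w w' : k} (h : w * w = -(t ^ 2) + (a * t ^ 2 + b) * w)
    (h' : w' * w' = -(t ^ 2) + (a * t ^ 2 + b) * w') : w' = w ∨ w' = a * t ^ 2 + b - w := by
  have : (w' - w) * (w' - (a * t ^ 2 + b - w)) = 0 := by linear_combination h' - h
  rcases mul_eq_zero.1 this with h1 | h1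
  · exact Or.inl (sub_eq_zero.1 h1)
  · exact Or.inr (sub_eq_zero.1 h1)

/-- The number of common zeros of high order is bounded by the pole order. -/
lemma mul_card_le (p : ℕ) [CharP k p] (hp : p.Prime) (ha : a ≠ 0) (hab : a * b ≠ 1) {M n : ℕ}
    (hM : 2 * M ≤ p) {F : MarkoffCurve a b} (hF : F ≠ 0) (hn : PoleLE n F) (S : Finset (k × k))
    (hS : ∀ P ∈ S, P.1 ≠ 0 ∧ 2 * P.2 ≠ a * P.1 ^ 2 + b ∧
      ∃ h : P.2 * P.2 = -(P.1 ^ 2) + (a * P.1 ^ 2 + b) * P.2, VanishesTo (ev P.1 P.2 h) M F) :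
    M * S.card ≤ 2 * n := by
  classical
  have hN := norm_ne_zero ha hab hF
  have hfib : ∀ t ∈ S.image Prod.fst,
      M * (S.filter fun P => P.1 = t).card ≤ F.norm.roots.count t := by
    intro t ht
    obtain ⟨⟨t, w⟩, hP, rfl⟩ := Finset.mem_image.1 ht
    obtain ⟨ht0, hw, h, hv⟩ := hS _ hP
    dsimp only at ht0 hw h hv ⊢
    rw [count_roots]
    have hsub : (S.filter fun P => P.1 = t) ⊆ {(t, w), (t, a * t ^ 2 + b - w)} := by
      rintro ⟨t', w'⟩ hP'
      obtain ⟨hPS, rfl : t' = t⟩ := Finset.mem_filter.1 hP'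
      obtain ⟨-, -, h', -⟩ := hS _ hPS
      rcases eq_or_eq_conj h h' with h1 | h1 <;> simp_all
    have halg := QuadraticAlgebra.algebraMap_norm_eq_mul_star F
    by_cases hc : (t, a * t ^ 2 + b - w) ∈ S
    · obtain ⟨-, -, h', hv'⟩ := hS _ hc
      have hle : M * (S.filter fun P => P.1 = t).card ≤ 2 * M := by
        rw [mul_comm]
        exact Nat.mul_le_mul_right _ ((Finset.card_le_card hsub).trans Finset.card_le_two)
      refine hle.trans (le_rootMultiplicity p hp ht0 h hw hM hN ?_)
      rw [halg, two_mul]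
      exact hv.mul hv'.star
    · have hsub' : (S.filter fun P => P.1 = t) ⊆ {(t, w)} := fun P hP' => by
        have := hsub hP'
        rw [Finset.mem_insert, Finset.mem_singleton] at this
        rcases this with rfl | rfl
        · simp
        · exact absurd (Finset.mem_filter.1 hP').1 hc
      have hle : M * (S.filter fun P => P.1 = t).card ≤ M * 1 :=
        Nat.mul_le_mul_left _ (Finset.card_le_card hsub')
      refine hle.trans (le_rootMultiplicity p hp ht0 h hw (by lia) hN ?_)
      rw [halg]
      have h0 : VanishesTo (ev t w h) 0 (star F) := vanishesTo_zero _
      simpa using hv.mul h0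
  have hsum : ∑ t ∈ S.image Prod.fst, F.norm.roots.count t ≤ F.norm.roots.card := by
    rw [← Multiset.toFinset_sum_count_eq]
    refine (Finset.sum_le_sum_of_ne_zero fun t _ h0 => ?_)
    rwa [Multiset.mem_toFinset, ← Multiset.count_ne_zero]
  calc M * S.card = ∑ t ∈ S.image Prod.fst, M * (S.filter fun P => P.1 = t).card := by
        rw [← Finset.mul_sum, ← Finset.card_eq_sum_card_image]
    _ ≤ _ := Finset.sum_le_sum hfib
    _ ≤ _ := hsum
    _ ≤ _ := card_roots' _
    _ ≤ _ := hn.natDegree_norm_le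

lemma iterate_der_sum {ι : Type*} (s : Finset ι) (r : ℕ) (f : ι → MarkoffCurve a b) :
    (der a b)^[r] (∑ i ∈ s, f i) = ∑ i ∈ s, (der a b)^[r] (f i) := by
  classical
  induction s using Finset.induction_on with
  | empty => simp
  | insert i s hi ih => rw [Finset.sum_insert hi, Finset.sum_insert hi, iterate_der_add, ih]

lemma vanishesTo_sum {M h e D I : ℕ} {c t w : k} (hP : w * w = -(t ^ 2) + (a * t ^ 2 + b) * w)
    (hth : t ^ h = 1) (hwe : w ^ e = c * t ^ e) {g : ℕ → ℕ → MarkoffCurve a b}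
    (hg : ∀ r < M, ∑ i ∈ Finset.range I, ∑ j ∈ Finset.range (2 * D),
      c ^ j • (twist a b (h * i + e * (2 * D - 1 - j)) (e * j))^[r] (g i j) = 0) :
    VanishesTo (ev t w hP) M (∑ i ∈ Finset.range I, ∑ j ∈ Finset.range (2 * D),
      crd a b ^ (h * i + e * (2 * D - 1 - j)) * ω ^ (e * j) * g i j) := by
  intro r hr
  have h1 := congrArg (fun f => t ^ (e * (2 * D - 1)) * ev t w hP f) (hg r hr)
  rw [map_zero, mul_zero] at h1
  rw [iterate_der_sum, map_sum, ← h1, map_sum, Finset.mul_sum]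
  refine Finset.sum_congr rfl fun i _ => ?_
  rw [iterate_der_sum, map_sum, map_sum, Finset.mul_sum]
  refine Finset.sum_congr rfl fun j hj => ?_
  have hj := Finset.mem_range.1 hj
  rw [iterate_der_mul_twist, map_mul, map_mul, map_pow, map_pow]
  generalize (twist a b (h * i + e * (2 * D - 1 - j)) (e * j))^[r] (g i j) = f
  have hc : ev t w hP (crd a b) = t := by simp [ev_apply, crd]
  have ho : ev t w hP ω = w := by simp [ev_apply]
  have hs : ev t w hP (c ^ j • f) = c ^ j * ev t w hP f := by simp [ev_apply]; ring
  have h5 : t ^ (e * (2 * D - 1)) = t ^ (e * (2 * D - 1 - j)) * t ^ (e * j) := by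
    rw [← pow_add, ← mul_add]
    congr 2
    lia
  rw [hc, ho, hs, h5, pow_add, pow_mul t h, hth, one_pow, one_mul, pow_mul w, hwe, mul_pow,
    ← pow_mul]
  ring

/-- The Stepanov bound, before optimization of the parameters. -/
lemma stepanov_bound (p : ℕ) [Fact p.Prime] [CharP k p] (ha : a ≠ 0)
    (hb : b ≠ 0) (hab : a * b ≠ 1) (h2 : (2 : k) ≠ 0) (hap : a ^ p = a) (hbp : b ^ p = b)
    {h m D e : ℕ} (hh : h * m + 1 = p) (hm : 0 < m) (hD : 0 < D)
    (he : e * D = p + 1 ∨ e * D + 1 = p)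
    {ζ : k} (hζ : IsPrimitiveRoot ζ D) {d I M : ℕ} (hdeg : 2 * D * (d + 12) < h) (hM : 2 * M ≤ p)
    (hI : M * (d + 2 * M) < I * (2 * D * d)) (c : k) (S : Finset (k × k))
    (hS : ∀ P ∈ S, P.2 * P.2 = -(P.1 ^ 2) + (a * P.1 ^ 2 + b) * P.2 ∧ P.1 ≠ 0 ∧
      2 * P.2 ≠ a * P.1 ^ 2 + b ∧ P.1 ^ h = 1 ∧ P.2 ^ e = c * P.1 ^ e) :
    M * S.card ≤ 2 * (h * I + 4 * (p + 1) + d + 1) := by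
  obtain ⟨g, hg, ⟨i₀, hi₀, j₀, hj₀, hg₀⟩, hgM⟩ := exists_auxiliary a b c
    (fun i j => h * i + e * (2 * D - 1 - j)) (fun _ j => e * j)
    (I := I) (J := 2 * D) (M := M) (d := d) (by lia)
  refine mul_card_le p Fact.out ha hab hM
    (sum_ne_zero p ha hb hab h2 hap hbp hh hm hD he hζ hg hdeg hi₀ hj₀ hg₀)
    (PoleLE.sum _ fun i hi => PoleLE.sum _ fun j hj => ?_) S fun P hP => ?_
  · have hi := Finset.mem_range.1 hi
    have hj := Finset.mem_range.1 hj
    refine (((poleLE_crd.pow _).mul (poleLE_omega.pow _)).mul (hg i j).poleLE).mono ?_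
    have h1 : h * i ≤ h * I := Nat.mul_le_mul_left _ hi.le
    have h3 : e * (2 * D - 1 - j) + e * j = e * (2 * D - 1) := by
      rw [← mul_add]
      congr 1
      lia
    have h4 : e * (2 * D - 1) ≤ e * (2 * D) := Nat.mul_le_mul_left _ (by lia)
    have h5 : e * (2 * D) = 2 * (e * D) := by ring
    lia
  · obtain ⟨h1, h3, h4, h5, h6⟩ := hS P hP
    exact ⟨h3, h4, h1, vanishesTo_sum h1 h5 h6 hgM⟩

end MarkoffCurve

namespace MarkoffCurve

variable {k : Type*} [Field k] {a b : k}

/-- There are at most `2 * e` points such that `w / t` is an `e`-th root of `c`. -/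
lemma card_le_two_mul (ha : a ≠ 0) {e : ℕ} (he : 0 < e) (c : k) (S : Finset (k × k))
    (hS : ∀ P ∈ S, P.2 * P.2 = -(P.1 ^ 2) + (a * P.1 ^ 2 + b) * P.2 ∧ P.1 ≠ 0 ∧
      P.2 ^ e = c * P.1 ^ e) : S.card ≤ 2 * e := by
  classical
  have h1 : S.image (fun P => P.2 / P.1) ⊆ (nthRoots e c).toFinset := by
    intro y hy
    obtain ⟨P, hP, rfl⟩ := Finset.mem_image.1 hy
    obtain ⟨-, h2, h3⟩ := hS P hP
    rw [Multiset.mem_toFinset, mem_nthRoots he, div_pow, h3]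
    exact mul_div_cancel_right₀ _ (pow_ne_zero _ h2)
  have h2 : (S.image fun P => P.2 / P.1).card ≤ e :=
    (Finset.card_le_card h1).trans ((Multiset.toFinset_card_le _).trans (card_nthRoots e c))
  refine (Finset.card_le_mul_card_image (f := fun P : k × k => P.2 / P.1) S 2 fun y hy => ?_).trans
    (Nat.mul_le_mul_left 2 h2)
  obtain ⟨⟨t, w⟩, hP, rfl⟩ := Finset.mem_image.1 hy
  obtain ⟨h3, h4, -⟩ := hS _ hP
  dsimp only at h3 h4 ⊢
  have hw : w ≠ 0 := by
    rintro rfl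
    simp at h3
    exact h4 h3
  have key : ∀ s, a * w * s ^ 2 * t - (w ^ 2 + t ^ 2) * s + b * w * t = 0 →
      s = t ∨ s = b / (a * t) := by
    intro s hs
    have h5 : (s - t) * (a * t * s - b) * w = 0 := by
      linear_combination hs + s * h3
    rcases mul_eq_zero.1 ((mul_eq_zero.1 h5).resolve_right hw) with h | h
    · exact Or.inl (sub_eq_zero.1 h)
    · right
      rw [eq_div_iff (mul_ne_zero ha h4)]
      linear_combination h
  refine (Finset.card_le_card (t := {(t, w), (b / (a * t), b / (a * t) * (w / t))}) ?_).trans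
    Finset.card_le_two
  rintro ⟨s, v⟩ hQ
  obtain ⟨hQ, hsv : v / s = w / t⟩ := Finset.mem_filter.1 hQ
  obtain ⟨h5, h6, -⟩ := hS _ hQ
  dsimp only at h5 h6
  have hv : v = s * (w / t) := by rw [← hsv]; field_simp
  have h7 : v * t = s * w := by rw [hv]; field_simp
  have h8 : a * w * s ^ 2 * t - (w ^ 2 + t ^ 2) * s + b * w * t = 0 := by
    refine mul_left_cancel₀ h6 ?_
    linear_combination -t ^ 2 * h5 + (v * t + s * w - (a * s ^ 2 + b) * t) * h7
  rcases key s h8 with rfl | rfl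
  · simp [hv, mul_div_cancel₀, h4]
  · simp [hv]

/-- The Stepanov bound for the points with `t ^ h = 1` and `(w / t) ^ e = c`. -/
theorem card_points_le [IsAlgClosed k] (p : ℕ) [Fact p.Prime] [CharP k p] (ha : a ≠ 0)
    (hb : b ≠ 0) (hab : a * b ≠ 1) (hap : a ^ p = a) (hbp : b ^ p = b)
    {h D e : ℕ} (hp : 5 ≤ p) (hh : h ∣ p - 1) (hph : p.sqrt ≤ h)
    (he : e * D = p + 1 ∨ e * D = p - 1) (c : k) (S : Finset (k × k))
    (hS : ∀ P ∈ S, P.2 * P.2 = -(P.1 ^ 2) + (a * P.1 ^ 2 + b) * P.2 ∧ P.1 ≠ 0 ∧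
      2 * P.2 ≠ a * P.1 ^ 2 + b ∧ P.1 ^ h = 1 ∧ P.2 ^ e = c * P.1 ^ e) :
    D * S.card ≤ h + 384 * D * p.sqrt := by
  have heD : 0 < e * D := by lia
  have he0 : 0 < e := Nat.pos_of_mul_pos_right heD
  have hD0 : 0 < D := Nat.pos_of_mul_pos_left heD
  have hs1 : p.sqrt * p.sqrt ≤ p := Nat.sqrt_le p
  have hs2 : p < (p.sqrt + 1) * (p.sqrt + 1) := Nat.lt_succ_sqrt p
  have hs3 : 2 ≤ p.sqrt := Nat.le_sqrt.2 (by lia)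
  generalize p.sqrt = M at *
  have hs4 : p + 1 ≤ 4 * (M * M) := by nlinarith
  obtain ⟨m, hm⟩ := hh
  have hm0 : 0 < m := Nat.pos_of_ne_zero fun h => by subst h; lia
  have hhp : h + 1 ≤ p := by nlinarith [Nat.sub_add_cancel (show 1 ≤ p by lia)]
  rcases le_or_gt h (48 * D) with hcase | hcase
  · have h1 := card_le_two_mul ha he0 c S fun P hP =>
      ⟨(hS P hP).1, (hS P hP).2.1, (hS P hP).2.2.2.2⟩
    calc D * S.card ≤ D * (2 * e) := Nat.mul_le_mul_left _ h1
      _ = 2 * (e * D) := by ring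
      _ ≤ 2 * (4 * (M * M)) := by lia
      _ ≤ 2 * (4 * (48 * D * M)) := by gcongr; lia
      _ = 384 * D * M := by ring
      _ ≤ _ := Nat.le_add_left _ _
  · have h2 : (2 : k) ≠ 0 := by
      intro h
      have := (CharP.cast_eq_zero_iff k p 2).1 (by exact_mod_cast h)
      exact absurd (Nat.le_of_dvd (by simp) this) (by lia)
    have hDk : (D : k) ≠ 0 := by
      intro h
      have h3 := (CharP.cast_eq_zero_iff k p D).1 h
      have h4 : p ∣ e * D := h3.mul_left e
      rcases he with he | he
      · rw [he] at h4
        have := (Nat.dvd_add_right (dvd_refl p)).1 h4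
        exact absurd (Nat.le_of_dvd (by simp) this) (by lia)
      · exact absurd (Nat.le_of_dvd heD h4) (by lia)
    have : NeZero (D : k) := ⟨hDk⟩
    obtain ⟨ζ, hζ⟩ := HasEnoughRootsOfUnity.exists_primitiveRoot k D
    set d := h / (4 * D) with hd
    have hd1 : 4 * D * d ≤ h := Nat.mul_div_le h (4 * D)
    have hd2 : h < 4 * D * (d + 1) := Nat.lt_mul_div_succ h (by lia)
    have hd3 : 12 ≤ d := (Nat.le_div_iff_mul_le (by lia)).2 (by lia)
    clear_value d
    have hd4 : h ≤ 8 * D * d := by nlinarith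
    set I := M * (d + 2 * M) / (2 * D * d) + 1 with hI
    have hI1 : M * (d + 2 * M) < I * (2 * D * d) := by
      rw [mul_comm I]
      exact Nat.lt_mul_div_succ _ (by positivity)
    have hI2 : 2 * D * d * I ≤ M * (d + 2 * M) + 2 * D * d := by
      rw [hI, mul_add, mul_one]
      exact Nat.add_le_add_right (Nat.mul_div_le _ _) _
    clear_value I
    have key := stepanov_bound p ha hb hab h2 hap hbp (h := h) (m := m) (by lia) hm0 hD0
      (he.imp_right fun h => by lia) hζ (d := d) (I := I) (M := M) (by nlinarith) (by nlinarith)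
      hI1 c S hS
    refine le_of_mul_le_mul_left ?_ (show 0 < d * M by positivity)
    calc d * M * (D * S.card) = D * d * (M * S.card) := by ring
      _ ≤ D * d * (2 * (h * I + 4 * (p + 1) + d + 1)) := Nat.mul_le_mul_left _ key
      _ = h * (2 * D * d * I) + 2 * D * d * (4 * (p + 1) + (d + 1)) := by ring
      _ ≤ h * (M * (d + 2 * M) + 2 * D * d) + 2 * D * d * (4 * (4 * (M * M)) + 4 * (M * M)) := by
        gcongr
        nlinarith
      _ = h * (M * d) + (h * (2 * (M * M)) + h * (2 * D * d)) + 40 * D * d * (M * M) := by ring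
      _ ≤ h * (M * d) + ((8 * D * d) * (2 * (M * M)) + (4 * (M * M)) * (2 * D * d)) +
          40 * D * d * (M * M) := by
        gcongr
        lia
      _ = d * M * (h + 64 * D * M) := by ring
      _ ≤ d * M * (h + 384 * D * M) := by gcongr; lia

end MarkoffCurve

namespace MarkoffCurve

variable {k : Type*} [Field k] {a b : k}

/-- The unramified points `(t, w)` of the curve with `t ^ h = 1`. -/
def IsUnramifiedPoint (a b : k) (h : ℕ) (P : k × k) : Prop :=
  P.2 * P.2 = -(P.1 ^ 2) + (a * P.1 ^ 2 + b) * P.2 ∧ P.1 ≠ 0 ∧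
    2 * P.2 ≠ a * P.1 ^ 2 + b ∧ P.1 ^ h = 1

lemma card_ramified_le (ha : a ≠ 0) (T : Finset k)
    (hT : ∀ t ∈ T, (a * t ^ 2 + b) ^ 2 = 4 * t ^ 2) : T.card ≤ 4 := by
  set q : k[X] := (C a * X ^ 2 + C b) ^ 2 - C 4 * X ^ 2 with hq
  have hdeg : q.natDegree ≤ 4 := by rw [hq]; compute_degree
  have hq0 : q ≠ 0 := fun h0 => by
    have h4 : q.coeff 4 = a ^ 2 := by
      have : q = C (a ^ 2) * X ^ 4 + (C (2 * a * b - 4) * X ^ 2 + C (b ^ 2)) := by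
        rw [hq]
        simp only [map_pow, map_mul, map_sub, map_ofNat]
        ring
      rw [this, coeff_add, coeff_add, coeff_C_mul, coeff_C_mul, coeff_X_pow, coeff_X_pow, coeff_C]
      simp
    rw [h0, coeff_zero] at h4
    exact pow_ne_zero 2 ha h4.symm
  refine le_trans ?_ ((card_roots' q).trans hdeg)
  have hsub : T.val ≤ q.roots := by
    refine (Multiset.le_iff_subset T.nodup).2 fun t ht => ?_
    rw [mem_roots hq0, IsRoot, hq]
    simp [hT t ht]
  exact Multiset.card_le_card hsub

lemma exists_points [IsAlgClosed k] (h2 : (2 : k) ≠ 0) (ha : a ≠ 0) {h : ℕ} (T : Finset k)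
    (hT0 : ∀ t ∈ T, t ≠ 0) (hT : ∀ t ∈ T, t ^ h = 1) :
    ∃ S : Finset (k × k), (∀ P ∈ S, IsUnramifiedPoint a b h P ∧ P.1 ∈ T) ∧
      2 * T.card ≤ S.card + 8 := by
  classical
  have hroot : ∀ t : k, ∃ w : k, w * w = -(t ^ 2) + (a * t ^ 2 + b) * w := fun t => by
    obtain ⟨s, hs⟩ := IsAlgClosed.exists_pow_nat_eq ((a * t ^ 2 + b) ^ 2 - 4 * t ^ 2) two_pos
    refine ⟨(a * t ^ 2 + b + s) / 2, ?_⟩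
    field_simp
    linear_combination hs
  choose s hs using hroot
  set T' := T.filter fun t => (a * t ^ 2 + b) ^ 2 ≠ 4 * t ^ 2 with hT'
  have hcard : T.card ≤ T'.card + 4 := by
    rw [← Finset.card_filter_add_card_filter_not (s := T)
      (p := fun t => (a * t ^ 2 + b) ^ 2 ≠ 4 * t ^ 2)]
    refine Nat.add_le_add_left (card_ramified_le (b := b) ha _ fun t ht => ?_) _
    simpa using (Finset.mem_filter.1 ht).2
  have hne : ∀ t ∈ T', 2 * s t ≠ a * t ^ 2 + b := fun t ht h0 =>
    (Finset.mem_filter.1 ht).2 (by linear_combination (2 * s t - (a * t ^ 2 + b)) * h0 - 4 * hs t)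
  refine ⟨T'.image (fun t => (t, s t)) ∪ T'.image (fun t => (t, a * t ^ 2 + b - s t)),
    fun P hP => ?_, ?_⟩
  · rcases Finset.mem_union.1 hP with hP | hP <;> obtain ⟨t, ht, rfl⟩ := Finset.mem_image.1 hP <;>
      have htT := (Finset.mem_filter.1 ht).1
    · exact ⟨⟨hs t, hT0 t htT, hne t ht, hT t htT⟩, htT⟩
    · refine ⟨⟨?_, hT0 t htT, fun h0 => hne t ht ?_, hT t htT⟩, htT⟩
      · dsimp only
        linear_combination hs t
      · dsimp only at h0
        linear_combination -h0
  · rw [Finset.card_union_of_disjoint, Finset.card_image_of_injective,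
      Finset.card_image_of_injective]
    · lia
    · exact fun x y h => congrArg Prod.fst h
    · exact fun x y h => congrArg Prod.fst h
    · rw [Finset.disjoint_left]
      intro P hP hP'
      obtain ⟨t, ht, rfl⟩ := Finset.mem_image.1 hP
      obtain ⟨t', -, h⟩ := Finset.mem_image.1 hP'
      obtain ⟨rfl, h⟩ := Prod.mk.inj h
      exact hne t' ht (by linear_combination -h)

section Bound

variable [IsAlgClosed k] (p : ℕ) [Fact p.Prime] [CharP k p]

/-- The Stepanov bound for a union of fibres of `(w / t) ^ e`. -/
lemma card_filter_mem_le (ha : a ≠ 0) (hb : b ≠ 0) (hab : a * b ≠ 1) (hap : a ^ p = a)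
    (hbp : b ^ p = b) {h D e : ℕ} (hp : 5 ≤ p) (hh : h ∣ p - 1) (hph : p.sqrt ≤ h)
    (he : e * D = p + 1 ∨ e * D = p - 1) (S : Finset (k × k))
    (hS : ∀ P ∈ S, IsUnramifiedPoint a b h P) (Z : Finset k)
    (hZ : ∀ P ∈ S, (P.2 / P.1) ^ e ∈ Z) :
    (S.card : ℝ) ≤ Z.card * ((h : ℝ) / D + 384 * p.sqrt) := by
  classical
  have hD : 0 < D := Nat.pos_of_mul_pos_left (show 0 < e * D by lia)
  have hD' : (0 : ℝ) < D := by exact_mod_cast hD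
  rw [Finset.card_eq_sum_card_fiberwise (f := fun P : k × k => (P.2 / P.1) ^ e) (t := Z) hZ]
  push_cast
  rw [← nsmul_eq_mul]
  refine Finset.sum_le_card_nsmul _ _ _ fun c _ => ?_
  have h1 := card_points_le p ha hb hab hap hbp hp hh hph he c
    (S.filter fun P => (P.2 / P.1) ^ e = c) fun P hP => by
      obtain ⟨hP, hc⟩ := Finset.mem_filter.1 hP
      obtain ⟨h1, h2, h3, h4⟩ := hS P hP
      refine ⟨h1, h2, h3, h4, ?_⟩
      rw [← hc, div_pow, div_mul_cancel₀ _ (pow_ne_zero _ h2)]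
  have h2 : (D : ℝ) * (S.filter fun P => (P.2 / P.1) ^ e = c).card ≤
      h + 384 * D * p.sqrt := by exact_mod_cast h1
  rw [div_add' _ _ _ hD'.ne', le_div_iff₀ hD']
  linarith


/-- If every bad family is small, then there is a point whose `y`-coordinate has full order. -/
theorem exists_point_of_card (ha : a ≠ 0) (hb : b ≠ 0) (hab : a * b ≠ 1) (hap : a ^ p = a)
    (hbp : b ^ p = b) {h : ℕ} (hp : 5 ≤ p) (hh : h ∣ p - 1) (hph : p.sqrt ≤ h)
    (T : Finset k) (hT0 : ∀ t ∈ T, t ≠ 0) (hT : ∀ t ∈ T, t ^ h = 1) (hTp : ∀ t ∈ T, t ^ p = t)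
    (hTh : T.card = h) {d : ℕ} {Q : Finset ℕ} (hd : d ∣ p - 1)
    (hQ : ∀ q ∈ Q, q ≠ 0 ∧ d * q ∣ p - 1)
    (hdQ : ∀ q, q.Prime → q ∣ p - 1 → q ∣ d ∨ q ∈ Q)
    (hlt : 8 + 384 * (p.sqrt : ℝ) + (d - (d.totient : ℝ)) * ((h : ℝ) / d + 384 * p.sqrt) +
      ∑ q ∈ Q, d.totient * ((h : ℝ) / (d * q : ℕ) + 384 * p.sqrt) < h) :
    ∃ P : k × k, P.2 * P.2 = -(P.1 ^ 2) + (a * P.1 ^ 2 + b) * P.2 ∧ P.1 ∈ T ∧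
      (P.2 / P.1) ^ (p - 1) = 1 ∧
      ∀ q, q.Prime → q ∣ p - 1 → (P.2 / P.1) ^ ((p - 1) / q) ≠ 1 := by
  classical
  have hN : 0 < p - 1 := by lia
  have hd0 : 0 < d := Nat.pos_of_dvd_of_pos hd hN
  have h2 : (2 : k) ≠ 0 := by
    intro h
    have := (CharP.cast_eq_zero_iff k p 2).1 (by exact_mod_cast h)
    exact absurd (Nat.le_of_dvd (by simp) this) (by lia)
  have : NeZero (d : k) := ⟨fun h0 => absurd
    (Nat.le_of_dvd hN (((CharP.cast_eq_zero_iff k p d).1 h0).trans hd)) (by lia)⟩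
  obtain ⟨ζ, hζ⟩ := HasEnoughRootsOfUnity.exists_primitiveRoot k d
  obtain ⟨S, hS, hScard⟩ := exists_points (b := b) h2 ha T hT0 hT
  by_contra! hbad
  set Z := nthRootsFinset d (1 : k) \ primitiveRoots d k with hZ
  have hZcard : (Z.card : ℝ) ≤ d - d.totient := by
    have hsub : primitiveRoots d k ⊆ nthRootsFinset d (1 : k) := fun z hz =>
      (mem_nthRootsFinset hd0 _).2 (isPrimitiveRoot_of_mem_primitiveRoots hz).pow_eq_one
    have h1 := Finset.card_sdiff_add_card_eq_card hsub
    rw [hζ.card_primitiveRoots, hζ.card_nthRootsFinset] at h1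
    rw [le_sub_iff_add_le]
    exact_mod_cast h1.le
  set S₀ := S.filter fun P => (P.2 / P.1) ^ (p + 1) ∈ ({1} : Finset k)
  set S₁ := S.filter fun P => (P.2 / P.1) ^ ((p - 1) / d) ∈ Z
  set S₂ : ℕ → Finset (k × k) := fun q =>
    S.filter fun P => (P.2 / P.1) ^ ((p - 1) / (d * q)) ∈ primitiveRoots d k with hS₂
  have hcover : S ⊆ S₀ ∪ S₁ ∪ Q.biUnion S₂ := by
    rintro ⟨t, w⟩ hP
    obtain ⟨⟨hc, ht, -, -⟩, htT⟩ := hS _ hP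
    have htp := hTp t htT
    dsimp only at hc ht htp
    have hw : w ≠ 0 := by
      rintro rfl
      simp at hc
      exact ht hc
    have hcp := markoff_frobenius p hap hbp hc
    rw [htp] at hcp
    simp only [Finset.mem_union, Finset.mem_biUnion]
    rcases eq_or_eq_conj hc hcp with h1 | h1
    · have hy : (w / t) ^ (p - 1) = 1 := by
        have h3 : (w / t) ^ (p - 1) * (w / t) = 1 * (w / t) := by
          rw [pow_sub_one_mul (by lia), div_pow, htp, h1, one_mul]
        exact mul_right_cancel₀ (div_ne_zero hw ht) h3
      obtain ⟨q, hq, hqN, hyq⟩ := hbad (t, w) hc htT hy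
      dsimp only at hyq
      have hz : ((w / t) ^ ((p - 1) / d)) ^ d = 1 := by
        rw [← pow_mul, Nat.div_mul_cancel hd, hy]
      by_cases hprim : IsPrimitiveRoot ((w / t) ^ ((p - 1) / d)) d
      · right
        rcases hdQ q hq hqN with hqd | hqQ
        · exfalso
          have h3 : ((w / t) ^ ((p - 1) / d)) ^ (d / q) = 1 := by
            rw [← pow_mul, Nat.div_mul_div_comm hd hqd, mul_comm d q,
              Nat.mul_div_mul_right _ _ hd0, hyq]
          have h4 := Nat.le_of_dvd (Nat.div_pos (Nat.le_of_dvd hd0 hqd) hq.pos)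
            (hprim.dvd_of_pow_eq_one _ h3)
          exact absurd h4 (not_le.2 (Nat.div_lt_self hd0 hq.one_lt))
        · refine ⟨q, hqQ, Finset.mem_filter.2 ⟨hP, ?_⟩⟩
          rw [mem_primitiveRoots hd0]
          have hdq := (hQ q hqQ).2
          obtain ⟨r, hr⟩ := hdq
          have e1 : (p - 1) / (d * q) = r := by
            rw [hr]; exact Nat.mul_div_cancel_left _ (Nat.mul_pos hd0 hq.pos)
          have e2 : (p - 1) / q = r * d := by
            rw [hr, mul_comm d q, mul_assoc, mul_comm d r]
            exact Nat.mul_div_cancel_left _ hq.pos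
          have e3 : (p - 1) / d = r * q := by
            rw [hr, mul_assoc, mul_comm q r]
            exact Nat.mul_div_cancel_left _ hd0
          rw [e2, pow_mul] at hyq
          rw [e3, pow_mul] at hprim
          dsimp only
          rw [e1]
          refine ⟨hyq, fun l hl => hprim.dvd_of_pow_eq_one l ?_⟩
          rw [← pow_mul, mul_comm, pow_mul, hl, one_pow]
      · left; right
        refine Finset.mem_filter.2 ⟨hP, ?_⟩
        rw [hZ, Finset.mem_sdiff, mem_nthRootsFinset hd0, mem_primitiveRoots hd0]
        exact ⟨hz, hprim⟩
    · left; left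
      refine Finset.mem_filter.2 ⟨hP, ?_⟩
      rw [Finset.mem_singleton]
      dsimp only
      rw [div_pow, pow_succ w, pow_succ t, htp, h1, div_eq_one_iff_eq (mul_ne_zero ht ht)]
      linear_combination -hc
  have hS₀card := card_filter_mem_le p ha hb hab hap hbp (D := 1) hp hh hph (Or.inl (mul_one _)) S₀
    (fun P hP => (hS P (Finset.mem_filter.1 hP).1).1) _ fun P hP => (Finset.mem_filter.1 hP).2
  have hS₁card := card_filter_mem_le p ha hb hab hap hbp hp hh hph
    (Or.inr (Nat.div_mul_cancel hd)) S₁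
    (fun P hP => (hS P (Finset.mem_filter.1 hP).1).1) _ fun P hP => (Finset.mem_filter.1 hP).2
  have hS₂card : ∀ q ∈ Q, ((S₂ q).card : ℝ) ≤
      d.totient * ((h : ℝ) / (d * q : ℕ) + 384 * p.sqrt) := fun q hq => by
    have := card_filter_mem_le p ha hb hab hap hbp hp hh hph
      (Or.inr (Nat.div_mul_cancel (hQ q hq).2)) (S₂ q)
      (fun P hP => (hS P (Finset.mem_filter.1 hP).1).1) _ fun P hP => (Finset.mem_filter.1 hP).2
    rwa [hζ.card_primitiveRoots] at this
  have hcard : S.card ≤ S₀.card + S₁.card + ∑ q ∈ Q, (S₂ q).card :=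
    (Finset.card_le_card hcover).trans <| (Finset.card_union_le _ _).trans <|
      add_le_add (Finset.card_union_le _ _) Finset.card_biUnion_le
  have hcard' : (S.card : ℝ) ≤ S₀.card + S₁.card + ∑ q ∈ Q, ((S₂ q).card : ℝ) := by
    exact_mod_cast hcard
  have hScard' : 2 * (h : ℝ) ≤ S.card + 8 := by
    rw [hTh] at hScard
    exact_mod_cast hScard
  have h5 := Finset.sum_le_sum hS₂card
  have h6 : (Z.card : ℝ) * ((h : ℝ) / d + 384 * p.sqrt) ≤
      (d - (d.totient : ℝ)) * ((h : ℝ) / d + 384 * p.sqrt) := by gcongr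
  simp only [Finset.card_singleton, Nat.cast_one, div_one, one_mul] at hS₀card
  linarith

end Bound

end MarkoffCurve

namespace MarkoffCurve

lemma zpowers_eq_top_of_pow_ne_one {G : Type*} [Group G] [Finite G] {n : ℕ} (hn : Nat.card G = n)
    (y : G) (hy : ∀ q, q.Prime → q ∣ n → y ^ (n / q) ≠ 1) : Subgroup.zpowers y = ⊤ := by
  refine Subgroup.eq_top_of_card_eq _ ?_
  rw [Nat.card_zpowers]
  exact (orderOf_eq_of_pow_and_pow_div_prime (hn ▸ Nat.card_pos) (hn ▸ pow_card_eq_one') hy).trans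
    hn.symm

lemma exists_unit_of_pow_eq_one {k : Type*} [Field k] (p : ℕ) [Fact p.Prime] [Algebra (ZMod p) k]
    {y : k} (hy : y ^ (p - 1) = 1) : ∃ u : (ZMod p)ˣ, algebraMap (ZMod p) k u = y := by
  obtain ⟨g, hg⟩ := IsCyclic.exists_generator (α := (ZMod p)ˣ)
  have h1 : IsPrimitiveRoot g (p - 1) := by
    have h2 := IsPrimitiveRoot.orderOf g
    rwa [orderOf_eq_card_of_forall_mem_zpowers hg, Nat.card_eq_fintype_card,
      ZMod.card_units_eq_totient, Nat.totient_prime Fact.out] at h2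
  have h2 : IsPrimitiveRoot (algebraMap (ZMod p) k g) (p - 1) :=
    (IsPrimitiveRoot.coe_units_iff.2 h1).map_of_injective (algebraMap (ZMod p) k).injective
  have : NeZero (p - 1) := ⟨(Nat.sub_pos_of_lt (Fact.out : p.Prime).one_lt).ne'⟩
  obtain ⟨i, -, hi⟩ := h2.eq_pow_of_pow_eq_one hy
  exact ⟨g ^ i, by rw [Units.val_pow_eq_pow_val, map_pow, hi]⟩

lemma markoff_eq {k : Type*} [Field k] {a b t y : k} (ht : t ≠ 0) (hy : y ≠ 0)
    (h : y * t * (y * t) = -(t ^ 2) + (a * t ^ 2 + b) * (y * t)) :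
    a * t + b * t⁻¹ = y + y⁻¹ := by
  field_simp
  refine mul_left_cancel₀ ht ?_
  linear_combination -h

/-- If every bad family is small, then the equation is solvable with `y` a primitive root. -/
theorem exists_primitive_root_of_card (p : ℕ) [Fact p.Prime] (hp : 5 ≤ p)
    (H : Subgroup (ZMod p)ˣ) (hph : p.sqrt ≤ Nat.card H) (a b : (ZMod p)ˣ) (hab : a * b ≠ 1)
    {d : ℕ} {Q : Finset ℕ} (hd : d ∣ p - 1) (hQ : ∀ q ∈ Q, q ≠ 0 ∧ d * q ∣ p - 1)
    (hdQ : ∀ q, q.Prime → q ∣ p - 1 → q ∣ d ∨ q ∈ Q)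
    (hlt : 8 + 384 * (p.sqrt : ℝ) +
      (d - (d.totient : ℝ)) * ((Nat.card H : ℝ) / d + 384 * p.sqrt) +
      ∑ q ∈ Q, d.totient * ((Nat.card H : ℝ) / (d * q : ℕ) + 384 * p.sqrt) < Nat.card H) :
    ∃ t ∈ H, ∃ y : (ZMod p)ˣ, Subgroup.zpowers y = ⊤ ∧
      (a : ZMod p) * (t : ZMod p) + (b : ZMod p) * ((t⁻¹ : (ZMod p)ˣ) : ZMod p) =
        (y : ZMod p) + ((y⁻¹ : (ZMod p)ˣ) : ZMod p) := by
  classical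
  let k := AlgebraicClosure (ZMod p)
  let φ := algebraMap (ZMod p) k
  have hφ : Function.Injective φ := φ.injective
  have : CharP k p := charP_of_injective_algebraMap hφ p
  have hcard : Nat.card (ZMod p)ˣ = p - 1 := by
    rw [Nat.card_eq_fintype_card, ZMod.card_units_eq_totient, Nat.totient_prime Fact.out]
  let ι : H → k := fun t => φ ((t : (ZMod p)ˣ) : ZMod p)
  have hι : Function.Injective ι := fun s t h => Subtype.ext (Units.ext (hφ h))
  have hunit : ∀ u : (ZMod p)ˣ, φ u ≠ 0 := fun u => (map_ne_zero φ).2 u.ne_zero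
  have hfrob : ∀ u : ZMod p, φ u ^ p = φ u := fun u => by rw [← map_pow, ZMod.pow_card]
  have hab' : φ a * φ b ≠ 1 := fun h => hab <| Units.ext <| hφ <| by
    rw [Units.val_mul, map_mul, h, Units.val_one, map_one]
  have : Fintype H := Fintype.ofFinite H
  obtain ⟨⟨t, w⟩, hc, ht, hy, hyq⟩ := exists_point_of_card p (hunit a) (hunit b) hab' (hfrob a)
    (hfrob b) hp (hcard ▸ H.card_subgroup_dvd_card) hph (Finset.univ.image ι)
    (fun x hx => by
      obtain ⟨s, -, rfl⟩ := Finset.mem_image.1 hx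
      exact hunit s)
    (fun x hx => by
      obtain ⟨s, -, rfl⟩ := Finset.mem_image.1 hx
      simp only [ι]
      rw [← map_pow, ← Units.val_pow_eq_pow_val, ← Subgroup.coe_pow, pow_card_eq_one',
        Subgroup.coe_one, Units.val_one, map_one])
    (fun x hx => by
      obtain ⟨s, -, rfl⟩ := Finset.mem_image.1 hx
      exact hfrob (s : (ZMod p)ˣ))
    (by rw [Finset.card_image_of_injective _ hι, Finset.card_univ, Nat.card_eq_fintype_card])
    hd hQ hdQ hlt
  obtain ⟨⟨s, hsH⟩, -, hs⟩ := Finset.mem_image.1 ht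
  obtain ⟨y, hyw⟩ := exists_unit_of_pow_eq_one p hy
  change φ s = t at hs
  dsimp only at hc hyq hyw
  refine ⟨s, hsH, y, zpowers_eq_top_of_pow_ne_one hcard y fun q hq hqN h1 => hyq q hq hqN ?_, ?_⟩
  · rw [← hyw, ← map_pow, ← Units.val_pow_eq_pow_val, h1, Units.val_one, map_one]
  · refine hφ ?_
    have ht0 : φ s ≠ 0 := hunit s
    have hy0 : φ y ≠ 0 := hunit y
    have hw : w = φ y * φ s := by
      change φ y = w / t at hyw
      rw [hyw, hs, div_mul_cancel₀]
      exact hs ▸ ht0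
    rw [← hs, hw] at hc
    rw [map_add, map_add, map_mul, map_mul, Units.val_inv_eq_inv_val, Units.val_inv_eq_inv_val,
      map_inv₀, map_inv₀]
    exact markoff_eq ht0 hy0 hc

end MarkoffCurve

section Sieve

lemma prod_primeFactors_filter_le (n W : ℕ) :
    ∏ q ∈ n.primeFactors with q ≤ W, q ≤ 4 ^ W := by
  refine le_trans ?_ (primorial_le_four_pow W)
  refine Finset.prod_le_prod_of_subset_of_one_le' (fun q hq => ?_) fun q hq _ => ?_
  · obtain ⟨h1, h2⟩ := Finset.mem_filter.1 hq
    exact Finset.mem_filter.2 ⟨Finset.mem_range.2 (by lia), Nat.prime_of_mem_primeFactors h1⟩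
  · exact (Finset.mem_filter.1 hq).2.one_le

lemma pow_card_primeFactors_filter_le {n : ℕ} (hn : n ≠ 0) (W : ℕ) :
    W ^ (n.primeFactors.filter (W < ·)).card ≤ n := by
  refine (Finset.pow_card_le_prod _ _ W fun q hq => (Finset.mem_filter.1 hq).2.le).trans ?_
  exact Nat.le_of_dvd (Nat.pos_of_ne_zero hn)
    ((Finset.prod_dvd_prod_of_subset _ _ _ (Finset.filter_subset _ _)).trans
      (Nat.prod_primeFactors_dvd n))

lemma prod_primeFactors_filter_mul_dvd (n W : ℕ) {q : ℕ} (hq : q ∈ n.primeFactors.filter (W < ·)) :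
    (∏ q ∈ n.primeFactors with q ≤ W, q) * q ∣ n := by
  classical
  obtain ⟨h1, h2⟩ := Finset.mem_filter.1 hq
  have h3 : q ∉ n.primeFactors.filter (· ≤ W) := fun h => by
    have := (Finset.mem_filter.1 h).2
    lia
  rw [mul_comm, ← Finset.prod_insert (f := fun q => q) h3]
  refine (Finset.prod_dvd_prod_of_subset _ _ _ (Finset.insert_subset h1
    (Finset.filter_subset _ _))).trans (Nat.prod_primeFactors_dvd n)

/-- The inequality behind the sieve over the prime divisors of `p - 1`. -/
lemma sieve_inequality {h L s : ℝ} {d W : ℕ} {Q : Finset ℕ} (hd : 0 < d) (hW : 0 < W)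
    (hQ : ∀ q ∈ Q, W ≤ q) (hQW : 2 * Q.card ≤ W) (hL : 0 ≤ L) (hLs : L ≤ s) (hs : 1 ≤ s)
    (hbig : 1552 * ((d : ℝ) ^ 2 * (s * (1 + Q.card))) < h) :
    8 + 384 * L + (d - (d.totient : ℝ)) * (h / d + 384 * L) +
      ∑ q ∈ Q, d.totient * (h / (d * q : ℕ) + 384 * L) < h := by
  have hd1 : (1 : ℝ) ≤ d := by exact_mod_cast hd
  have hφ1 : (1 : ℝ) ≤ d.totient := by exact_mod_cast Nat.totient_pos.2 hd
  have hφd : (d.totient : ℝ) ≤ d := by exact_mod_cast Nat.totient_le d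
  have hW' : (0 : ℝ) < W := by exact_mod_cast hW
  have hr : (0 : ℝ) ≤ Q.card := Nat.cast_nonneg _
  have hQW' : 2 * (Q.card : ℝ) ≤ W := by exact_mod_cast hQW
  have hh : 0 ≤ h := by
    refine le_trans ?_ hbig.le
    positivity
  simp only [Nat.cast_mul]
  set φ : ℝ := (d.totient : ℝ)
  set D : ℝ := (d : ℝ)
  set r : ℝ := (Q.card : ℝ)
  have h1 : ∑ q ∈ Q, φ * (h / (D * q) + 384 * L) ≤ r * (φ * (h / (D * W) + 384 * L)) := by
    rw [← nsmul_eq_mul]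
    refine Finset.sum_le_card_nsmul _ _ _ fun q hq => ?_
    have : (W : ℝ) ≤ q := by exact_mod_cast hQ q hq
    gcongr
  have h2 : r * (h / (D * W)) ≤ h / D / 2 := by
    rw [← div_div, ← mul_div_assoc, div_le_iff₀ hW']
    have h0 : 0 ≤ h / D := by positivity
    nlinarith
  have h3 : 776 * (D * (s * (1 + r))) < h / D / 2 := by
    rw [div_div, lt_div_iff₀ (by positivity)]
    nlinarith
  have h4 : D * (h / D) = h := by field_simp
  have h5 : φ * (r * (h / (D * W))) ≤ φ * (h / D / 2) := by gcongr
  have h6 : 8 + 384 * L + (D - φ) * (384 * L) + r * (φ * (384 * L)) ≤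
      776 * (D * (s * (1 + r))) := by
    have e1 : r * (φ * (384 * L)) ≤ r * (D * (384 * s)) := by gcongr
    have e2 : (D - φ) * (384 * L) ≤ D * (384 * s) := by
      have : D - φ ≤ D := by linarith
      gcongr
    have e3 : s ≤ D * s := by nlinarith
    have e4 : 0 ≤ r * (D * s) := by positivity
    nlinarith
  have h7 : h / D / 2 ≤ φ * (h / D / 2) := by
    have : 0 ≤ h / D / 2 := by positivity
    nlinarith
  nlinarith

open Filter Topology in
lemma eventually_parameters {δ : ℝ} (hδ : 0 < δ) : ∀ᶠ p : ℕ in atTop, 5 ≤ p ∧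
    max 1 (32 / δ) ≤ Real.log (⌊δ / 8 * Real.log p⌋₊ : ℝ) ∧
    1552 * (1 + Real.log p) < (p : ℝ) ^ (δ / 2) := by
  have hlog : Tendsto (fun p : ℕ => δ / 8 * Real.log p) atTop atTop :=
    (Real.tendsto_log_atTop.comp tendsto_natCast_atTop_atTop).const_mul_atTop (by positivity)
  have h1 : Tendsto (fun p : ℕ => Real.log (⌊δ / 8 * Real.log p⌋₊ : ℝ)) atTop atTop :=
    Real.tendsto_log_atTop.comp
      (tendsto_natCast_atTop_atTop.comp (tendsto_nat_floor_atTop.comp hlog))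
  have h2 : Tendsto (fun p : ℕ => (p : ℝ) ^ (δ / 4)) atTop atTop :=
    (tendsto_rpow_atTop (by positivity)).comp tendsto_natCast_atTop_atTop
  filter_upwards [eventually_ge_atTop 5, h1.eventually_ge_atTop (max 1 (32 / δ)),
    h2.eventually_gt_atTop (1552 * (1 + 4 / δ))] with p hp5 hp1 hp2
  refine ⟨hp5, hp1, ?_⟩
  have hp0 : (1 : ℝ) ≤ p := by exact_mod_cast (show 1 ≤ p by lia)
  have h3 := Real.log_le_rpow_div (zero_le_one.trans hp0) (show 0 < δ / 4 by positivity)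
  have h4 : 1 ≤ (p : ℝ) ^ (δ / 4) := Real.one_le_rpow hp0 (by positivity)
  have h5 : (p : ℝ) ^ (δ / 2) = (p : ℝ) ^ (δ / 4) * (p : ℝ) ^ (δ / 4) := by
    rw [← Real.rpow_add (by linarith)]
    congr 1
    ring
  rw [h5]
  set u := (p : ℝ) ^ (δ / 4)
  have h6 : 1552 * (1 + Real.log p) ≤ 1552 * (1 + 4 / δ) * u := by
    have : u / (δ / 4) = 4 / δ * u := by field_simp
    rw [this] at h3
    nlinarith
  nlinarith

end Sieve

theorem markoff_endgame_primitive_root (δ : ℝ) (hδ : 0 < δ) :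
    ∃ P₀ : ℕ, ∀ p : ℕ, p.Prime → P₀ ≤ p →
      ∀ H : Subgroup (ZMod p)ˣ, (p : ℝ) ^ ((1 : ℝ) / 2 + δ) ≤ (Nat.card H : ℝ) →
        ∀ a b : (ZMod p)ˣ, a * b ≠ 1 →
          ∃ t ∈ H, ∃ y : (ZMod p)ˣ, Subgroup.zpowers y = ⊤ ∧
            (a : ZMod p) * (t : ZMod p) + (b : ZMod p) * ((t⁻¹ : (ZMod p)ˣ) : ZMod p) =
              (y : ZMod p) + ((y⁻¹ : (ZMod p)ˣ) : ZMod p) := by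
  obtain ⟨P₀, hP₀⟩ := Filter.eventually_atTop.1 (eventually_parameters hδ)
  refine ⟨P₀, fun p hp hpP H hH a b hab => ?_⟩
  obtain ⟨hp5, hW, hbig⟩ := hP₀ p hpP
  have : Fact p.Prime := ⟨hp⟩
  have hp0 : (1 : ℝ) < p := by exact_mod_cast hp.one_lt
  have hx : 0 < Real.log p := Real.log_pos hp0
  set W := ⌊δ / 8 * Real.log p⌋₊
  have hWle : (W : ℝ) ≤ δ / 8 * Real.log p := Nat.floor_le (by positivity)
  have hWlt : δ / 8 * Real.log p < W + 1 := Nat.lt_floor_add_one _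
  have hW1 : 1 ≤ Real.log W := (le_max_left _ _).trans hW
  have hW2 : 32 / δ ≤ Real.log W := (le_max_right _ _).trans hW
  clear_value W
  have hW0 : 0 < W := Nat.pos_of_ne_zero fun h => by
    rw [h] at hW1
    norm_num at hW1
  have hW0' : (1 : ℝ) ≤ W := by exact_mod_cast hW0
  set d := ∏ q ∈ (p - 1).primeFactors with q ≤ W, q
  set Q := (p - 1).primeFactors.filter (W < ·)
  have hd0 : 0 < d := Finset.prod_pos fun q hq =>
    (Nat.prime_of_mem_primeFactors (Finset.mem_filter.1 hq).1).pos
  have hr : (Q.card : ℝ) * Real.log W ≤ Real.log p := by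
    rw [← Real.log_pow]
    refine Real.log_le_log (by positivity) ?_
    exact_mod_cast (pow_card_primeFactors_filter_le (n := p - 1) (by lia) W).trans (Nat.sub_le p 1)
  have hr0 : (0 : ℝ) ≤ Q.card := Nat.cast_nonneg _
  have hr1 : (Q.card : ℝ) ≤ Real.log p := by nlinarith
  have hr2 : 2 * Q.card ≤ W := by
    have h1 : (Q.card : ℝ) * (32 / δ) ≤ Real.log p :=
      (mul_le_mul_of_nonneg_left hW2 hr0).trans hr
    rw [← mul_div_assoc, div_le_iff₀ hδ] at h1
    have : 2 * (Q.card : ℝ) ≤ W := by linarith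
    exact_mod_cast this
  have hd2 : (d : ℝ) ^ 2 ≤ (p : ℝ) ^ (δ / 2) := by
    have h1 : (d : ℝ) ≤ 4 ^ W := by exact_mod_cast prod_primeFactors_filter_le (p - 1) W
    have h2 : (4 : ℝ) ≤ Real.exp 2 := by
      have := Real.add_one_le_exp (1 : ℝ)
      have h3 : Real.exp 2 = Real.exp 1 * Real.exp 1 := by rw [← Real.exp_add]; norm_num
      nlinarith
    have h3 : (d : ℝ) ≤ Real.exp (δ / 4 * Real.log p) := by
      refine h1.trans ((pow_le_pow_left₀ (by norm_num) h2 W).trans ?_)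
      rw [← Real.exp_nat_mul]
      exact Real.exp_le_exp.2 (by linarith)
    refine (pow_le_pow_left₀ (Nat.cast_nonneg d) h3 2).trans_eq ?_
    rw [Real.rpow_def_of_pos (by linarith), ← Real.exp_nat_mul]
    congr 1
    push_cast
    ring
  have hs1 : 1 ≤ Real.sqrt p := Real.one_le_sqrt.2 hp0.le
  have hsH :
      (p : ℝ) ^ ((1 : ℝ) / 2 + δ) = Real.sqrt p * ((p : ℝ) ^ (δ / 2) * (p : ℝ) ^ (δ / 2)) := by
    rw [Real.sqrt_eq_rpow, ← Real.rpow_add (by linarith), ← Real.rpow_add (by linarith)]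
    congr 1
    ring
  have hu : 1 ≤ (p : ℝ) ^ (δ / 2) := Real.one_le_rpow hp0.le (by positivity)
  rw [hsH] at hH
  set u := (p : ℝ) ^ (δ / 2)
  have hL : (p.sqrt : ℝ) ≤ Real.sqrt p := Real.nat_sqrt_le_real_sqrt
  have hLH : p.sqrt ≤ Nat.card H := by
    have h1 : Real.sqrt p ≤ Real.sqrt p * (u * u) :=
      le_mul_of_one_le_right (by linarith) (by nlinarith)
    exact_mod_cast hL.trans (h1.trans hH)
  refine MarkoffCurve.exists_primitive_root_of_card p hp5 H hLH a b hab (d := d) (Q := Q)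
    ((Finset.prod_dvd_prod_of_subset _ _ _ (Finset.filter_subset _ _)).trans
      (Nat.prod_primeFactors_dvd (p - 1)))
    (fun q hq => ⟨(Nat.prime_of_mem_primeFactors (Finset.mem_filter.1 hq).1).ne_zero,
      prod_primeFactors_filter_mul_dvd _ _ hq⟩)
    (fun q hq hqN => ?_)
    (sieve_inequality hd0 hW0 (fun q hq => (Finset.mem_filter.1 hq).2.le) hr2 (Nat.cast_nonneg _)
      hL hs1 (lt_of_lt_of_le ?_ hH))
  · have hqm : q ∈ (p - 1).primeFactors := Nat.mem_primeFactors.2 ⟨hq, hqN, by lia⟩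
    rcases le_or_gt q W with h | h
    · exact Or.inl (Finset.dvd_prod_of_mem _ (Finset.mem_filter.2 ⟨hqm, h⟩))
    · exact Or.inr (Finset.mem_filter.2 ⟨hqm, h⟩)
  · calc 1552 * ((d : ℝ) ^ 2 * (Real.sqrt p * (1 + Q.card)))
        ≤ 1552 * (u * (Real.sqrt p * (1 + Real.log p))) := by gcongr
      _ = Real.sqrt p * (u * (1552 * (1 + Real.log p))) := by ring
      _ < Real.sqrt p * (u * u) := by gcongr
end

section
/- Let p be a prime, K an algebraic closure of the field ℤ/pℤ, and let d, e be positive integers with p not dividing d·e. Let γ₁, γ₂ ∈ K with γ₁γ₂ ≠ 0 and γ₁γ₂ ≠ 1. Then the polynomial P(X,Y) = γ₁X^dY^{2e} + γ₂X^d − X^{2d}Y^e − Y^e is irreducible in K[X,Y]. (Equivalently, the affine curve γ₁y^e + γ₂y^{−e} = x^d + x^{−d} is absolutely irreducible over ℤ/pℤ.) -/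
open LaurentPolynomial in
theorem LaurentPolynomial.exists_eq_C_mul_T_of_isUnit {K : Type*} [Field K] {u : K[T;T⁻¹]}
    (hu : IsUnit u) : ∃ (a : K) (n : ℤ), a ≠ 0 ∧ u = C a * T n := by
  obtain ⟨v, huv⟩ := hu.exists_right_inv
  obtain ⟨n, P, hP⟩ := u.exists_T_pow
  obtain ⟨m, Q, hQ⟩ := v.exists_T_pow
  have hPQ : P * Q = Polynomial.X ^ (n + m) := by
    apply Polynomial.toLaurent_injective
    rw [map_mul, hP, hQ, Polynomial.toLaurent_X_pow]
    push_cast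
    rw [T_add]
    linear_combination T n * T m * huv
  obtain ⟨i, -, w, hw⟩ := (dvd_prime_pow Polynomial.prime_X _).1 (Dvd.intro _ hPQ)
  obtain ⟨c, hc, hcw⟩ := Polynomial.isUnit_iff.1 (w⁻¹).isUnit
  refine ⟨c, i - n, hc.ne_zero, ?_⟩
  have hPc : P = Polynomial.C c * Polynomial.X ^ i := by
    rw [hcw, ← hw]
    simp [mul_comm]
  rw [hPc, Polynomial.toLaurent_C_mul_X_pow] at hP
  rw [T_sub, ← mul_assoc, hP, mul_assoc, ← T_add]
  simp

open LaurentPolynomial in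
theorem LaurentPolynomial.coeff_eq_zero_of_isUnit {K : Type*} [Field K] {u : K[T;T⁻¹]}
    (hu : IsUnit u) {i j : ℤ} (hij : i ≠ j) : u.coeff i = 0 ∨ u.coeff j = 0 := by
  obtain ⟨a, n, -, rfl⟩ := exists_eq_C_mul_T_of_isUnit hu
  rw [← single_eq_C_mul_T]
  simp only [AddMonoidAlgebra.coeff_single, Finsupp.single_apply]
  grind

theorem LaurentPolynomial.isUnit_C_mul_T {K : Type*} [Field K] {a : K} (ha : a ≠ 0) (n : ℤ) :
    IsUnit (LaurentPolynomial.C a * LaurentPolynomial.T n) :=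
  (ha.isUnit.map LaurentPolynomial.C).mul (LaurentPolynomial.isUnit_T n)

open LaurentPolynomial in
theorem LaurentPolynomial.coeff_C_mul_T {K : Type*} [Field K] (a : K) (m n : ℤ) :
    (C a * T n).coeff m = if n = m then a else 0 := by
  rw [← single_eq_C_mul_T, AddMonoidAlgebra.coeff_single, Finsupp.single_apply]

open LaurentPolynomial in
theorem LaurentPolynomial.dickson_eval_ne {K : Type*} [Field K] [IsAlgClosed K] {l e : ℕ}
    (hl : 2 ≤ l) (hlK : (l : K) ≠ 0) (he : 0 < e) {c₁ c₂ : K} (h0 : c₁ * c₂ ≠ 0)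
    (h1 : c₁ * c₂ ≠ 1) (g : K[T;T⁻¹]) :
    (Polynomial.dickson 1 (1 : K[T;T⁻¹]) l).eval g ≠
      C c₁ * T (l * e) + C c₂ * T (-(l * e)) := by
  intro hg
  have hc₁ : c₁ ≠ 0 := left_ne_zero_of_mul h0
  have hc₂ : c₂ ≠ 0 := right_ne_zero_of_mul h0
  have key : ∀ x : K, x ≠ 0 → x ^ l = c₁ ∨ x ^ l = c₂⁻¹ →
      g.coeff e = x ∨ g.coeff (-e) = x⁻¹ := by
    intro x hx hxl
    have hD := Polynomial.dickson_one_one_eval_add_inv (C x * T (e : ℤ)) (C x⁻¹ * T (-e : ℤ))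
      (by rw [mul_mul_mul_comm, ← map_mul, ← T_add, mul_inv_cancel₀ hx]; simp) l
    simp only [mul_pow, ← map_pow, T_pow, inv_pow, mul_neg] at hD
    have hdvd := Polynomial.sub_dvd_eval_sub g (C x * T (e : ℤ) + C x⁻¹ * T (-e : ℤ))
      (Polynomial.dickson 1 (1 : K[T;T⁻¹]) l)
    rw [hg, hD] at hdvd
    have hu : IsUnit (g - (C x * T (e : ℤ) + C x⁻¹ * T (-e : ℤ))) := by
      refine isUnit_of_dvd_unit hdvd ?_
      rcases hxl with h | h <;> rw [h]
      · rw [add_sub_add_left_eq_sub, ← sub_mul, ← map_sub]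
        refine isUnit_C_mul_T (fun h' => h1 ?_) _
        rw [sub_eq_zero.1 h', mul_inv_cancel₀ hc₁]
      · rw [inv_inv, add_sub_add_right_eq_sub, ← sub_mul, ← map_sub]
        refine isUnit_C_mul_T (fun h' => h1 ?_) _
        rw [sub_eq_zero.1 h', inv_mul_cancel₀ hc₂]
    have hne : (e : ℤ) ≠ -e := by omega
    have := coeff_eq_zero_of_isUnit hu hne
    simpa [coeff_C_mul_T, hne, hne.symm, sub_eq_zero] using this
  have : NeZero (l : K) := ⟨hlK⟩
  obtain ⟨ζ, hζ⟩ := HasEnoughRootsOfUnity.exists_primitiveRoot K l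
  obtain ⟨a, ha⟩ := IsAlgClosed.exists_pow_nat_eq c₁ (by omega : 0 < l)
  obtain ⟨b, hb⟩ := IsAlgClosed.exists_pow_nat_eq c₂⁻¹ (by omega : 0 < l)
  have ha0 : a ≠ 0 := by rintro rfl; rw [zero_pow (by omega)] at ha; exact hc₁ ha.symm
  have hb0 : b ≠ 0 := by
    rintro rfl; rw [zero_pow (by omega)] at hb; exact inv_ne_zero hc₂ hb.symm
  have hζ0 : ζ ≠ 0 := hζ.ne_zero (by omega)
  have hζ1 : ζ ≠ 1 := hζ.ne_one (by omega)
  have hζa : (ζ * a) ^ l = c₁ := by rw [mul_pow, hζ.pow_eq_one, one_mul, ha]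
  have hc : c₁ ≠ c₂⁻¹ := fun h => h1 (by rw [h, inv_mul_cancel₀ hc₂])
  have hab : a ≠ b := fun h => hc (by rw [← ha, ← hb, h])
  have hζab : ζ * a ≠ b := fun h => hc (by rw [← hζa, ← hb, h])
  have haζ : a ≠ ζ * a := fun h => hζ1 (mul_right_cancel₀ ha0 (by rw [one_mul, ← h]))
  have k1 := key a ha0 (.inl ha)
  have k2 := key (ζ * a) (mul_ne_zero hζ0 ha0) (.inl hζa)
  have k3 := key b hb0 (.inr hb)
  have i1 : a⁻¹ ≠ b⁻¹ := inv_injective.ne hab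
  have i2 : (ζ * a)⁻¹ ≠ b⁻¹ := inv_injective.ne hζab
  have i3 : a⁻¹ ≠ (ζ * a)⁻¹ := inv_injective.ne haζ
  grind

section

open Polynomial
open scoped LaurentPolynomial

theorem Polynomial.dickson_one_one_monic_natDegree (R : Type*) [CommRing R] [Nontrivial R] (n : ℕ) :
    (dickson 1 (1 : R) (n + 1)).Monic ∧ (dickson 1 (1 : R) (n + 1)).natDegree = n + 1 := by
  induction n using Nat.twoStepInduction with
  | zero => simp [monic_X]
  | one =>
    have h : dickson 1 (1 : R) 2 = X ^ 2 - C 2 := by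
      rw [dickson_two, C_1, C_ofNat]; norm_num
    rw [h]
    exact ⟨monic_X_pow_sub_C _ (by omega), natDegree_X_pow_sub_C⟩
  | more n ih1 ih2 =>
    rw [dickson_add_two, C_1, one_mul]
    have hm := monic_X.mul ih2.1
    have hd : (X * dickson 1 (1 : R) (n + 1 + 1)).natDegree = n + 1 + 1 + 1 := by
      rw [monic_X.natDegree_mul ih2.1, ih2.2, natDegree_X]; ring
    have hlt : (dickson 1 (1 : R) (n + 1)).natDegree <
        (X * dickson 1 (1 : R) (n + 1 + 1)).natDegree := by
      rw [ih1.2, hd]; omega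
    exact ⟨hm.sub_of_left (degree_lt_degree hlt),
      (natDegree_sub_eq_left_of_natDegree_lt hlt).trans hd⟩

/-- A root in the fraction field whose denominator becomes a unit under an injective ring
homomorphism gives a root in the target. -/
theorem exists_eval₂_eq_zero_of_aeval_eq_zero {A F R : Type*} [CommRing A] [IsDomain A]
    [UniqueFactorizationMonoid A] [Field F] [Algebra A F] [IsFractionRing A F] [CommRing R]
    [IsDomain R] {j : A →+* R} (hj : Function.Injective j) {q : A[X]}
    (hq : IsUnit (j q.leadingCoeff)) {r : F} (hr : aeval r q = 0) :
    ∃ s : R, q.eval₂ j s = 0 := by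
  have hden : IsUnit (j (IsFractionRing.den A r)) :=
    isUnit_of_dvd_unit (map_dvd j (den_dvd_of_is_root hr)) hq
  obtain ⟨v, hv⟩ := hden.exists_right_inv
  obtain ⟨L, _, ι, hι⟩ : ∃ (L : Type _) (_ : Field L) (ι : R →+* L), Function.Injective ι :=
    ⟨FractionRing R, inferInstance, algebraMap R _, IsFractionRing.injective R _⟩
  have hιj : Function.Injective (ι.comp j) := hι.comp hj
  let φ : F →+* L := IsFractionRing.lift hιj
  have hφ : ∀ a, φ (algebraMap A F a) = ι (j a) := IsFractionRing.lift_algebraMap hιj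
  refine ⟨j (IsFractionRing.num A r) * v, hι ?_⟩
  have hφr : φ r = ι (j (IsFractionRing.num A r) * v) := by
    have h : r * algebraMap A F (IsFractionRing.den A r) =
      algebraMap A F (IsFractionRing.num A r) := IsFractionRing.num_mul_den_eq_num_iff_eq.2 rfl
    apply_fun φ at h
    rw [map_mul, hφ, hφ] at h
    have hv' := congrArg ι hv
    rw [map_mul, map_one] at hv'
    rw [map_mul, ← h, mul_assoc, hv', mul_one]
  have hφ' : φ.comp (algebraMap A F) = ι.comp j := RingHom.ext hφ
  rw [map_zero, hom_eval₂, ← hφr, ← hφ', ← hom_eval₂, ← aeval_def, hr, map_zero]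

open IntermediateField in
theorem X_pow_sub_C_irreducible_of_sq_eq_neg_one {K : Type*} [Field K] {n : ℕ} (hn : n ≠ 0)
    {i : K} (hi : i ^ 2 = -1) {a : K} (ha : ∀ p : ℕ, p.Prime → p ∣ n → ∀ b : K, b ^ p ≠ a) :
    Irreducible (X ^ n - C a) := by
  induction n using induction_on_primes generalizing K with
  | zero => exact absurd rfl hn
  | one => simpa using irreducible_X_sub_C a
  | prime_mul p n hp IH =>
    rw [mul_comm]
    apply X_pow_mul_sub_C_irreducible
      (X_pow_sub_C_irreducible_of_prime hp (ha p hp (dvd_mul_right _ _)))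
    intro E _ _ x hx
    have : IsIntegral K x := not_not.mp fun h ↦ by
      simpa only [degree_zero, degree_X_pow_sub_C hp.pos,
        WithBot.natCast_ne_bot] using congr_arg degree (hx.symm.trans (dif_neg h))
    apply IH (right_ne_zero_of_mul hn) (i := algebraMap K _ i) (by rw [← map_pow, hi]; simp)
    intro q hq hqn b hb
    have hqa := ha q hq (dvd_mul_of_dvd_right hqn p)
    have hN : Algebra.norm K b ^ q = (-1) ^ p * -a := by
      rw [← map_pow, hb, ← adjoin.powerBasis_gen this,
        Algebra.PowerBasis.norm_gen_eq_coeff_zero_minpoly]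
      simp [minpoly_gen, hx, hp.ne_zero.symm]
    rcases hp.eq_two_or_odd' with rfl | hp2
    · rcases hq.eq_two_or_odd' with rfl | hq2
      · exact hqa (i * Algebra.norm K b) (by rw [mul_pow, hN, hi]; ring)
      · exact hqa (-Algebra.norm K b) (by rw [hq2.neg_pow, hN]; ring)
    · exact hqa (Algebra.norm K b) (by rw [hN, hp2.neg_one_pow]; ring)
/-- The quadratic satisfied by `X ^ d` over the function field in the other variable. -/
theorem irreducible_quadratic {K F : Type*} [Field K] [Field F] [Algebra K[X] F]
    [IsFractionRing K[X] F] {e : ℕ} (he : 0 < e) {γ₁ γ₂ : K} (h0 : γ₁ * γ₂ ≠ 0)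
    (h1 : γ₁ * γ₂ ≠ 1) {f : F} (hf : f * algebraMap K[X] F (X ^ e) =
      algebraMap K[X] F (C γ₁ * X ^ (2 * e) + C γ₂)) :
    Irreducible (X ^ 2 - C f * X + 1 : F[X]) := by
  have hdeg : (X ^ 2 - C f * X + 1 : F[X]).natDegree = 2 := by compute_degree!
  refine irreducible_of_degree_le_three_of_not_isRoot (by rw [hdeg]; decide) fun z hz => ?_
  have hz' : z ^ 2 - f * z + 1 = 0 := by simpa [IsRoot] using hz
  set q : K[X][X] := C (X ^ e) * X ^ 2 - C (C γ₁ * X ^ (2 * e) + C γ₂) * X + C (X ^ e) with hq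
  have hXe : (X ^ e : K[X]) ≠ 0 := pow_ne_zero _ X_ne_zero
  have hqdeg : q.natDegree = 2 := by rw [hq]; compute_degree!
  have hlead : q.leadingCoeff = X ^ e := by
    have hcoeff (a b : K[X]) : (C a * X ^ 2 - C b * X + C a).coeff 2 = a := by
      simp
    rw [leadingCoeff, hqdeg, hq, hcoeff]
  have hqz : aeval z q = 0 := by
    rw [hq]
    simp only [map_add, map_sub, map_mul, aeval_C, aeval_X, map_pow] at hf ⊢
    linear_combination (algebraMap K[X] F X) ^ e * hz' + z * hf
  obtain ⟨s, hs⟩ := exists_eval₂_eq_zero_of_aeval_eq_zero (j := (toLaurent : K[X] →+* K[T;T⁻¹]))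
    toLaurent_injective (by rw [hlead, toLaurent_X_pow]; exact LaurentPolynomial.isUnit_T _) hqz
  rw [hq] at hs
  simp only [eval₂_add, eval₂_sub, eval₂_mul, eval₂_C, eval₂_X, eval₂_pow, map_add, map_mul,
    toLaurent_C, toLaurent_X_pow] at hs
  have hT : (LaurentPolynomial.T e * LaurentPolynomial.T (-e) : K[T;T⁻¹]) = 1 := by
    rw [← LaurentPolynomial.T_add]; simp
  have hT2 : (LaurentPolynomial.T (2 * e : ℕ) : K[T;T⁻¹]) =
      LaurentPolynomial.T e * LaurentPolynomial.T e := by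
    rw [← LaurentPolynomial.T_add]; congr 1; push_cast; ring
  have hw : s * (LaurentPolynomial.C γ₁ * LaurentPolynomial.T e +
      LaurentPolynomial.C γ₂ * LaurentPolynomial.T (-e) - s) = 1 := by
    rw [hT2] at hs
    linear_combination (-LaurentPolynomial.T (-e)) * hs +
      (s ^ 2 + 1 - s * LaurentPolynomial.C γ₁ * LaurentPolynomial.T e) * hT
  obtain ⟨a, n, ha, rfl⟩ :=
    LaurentPolynomial.exists_eq_C_mul_T_of_isUnit (IsUnit.of_mul_eq_one _ hw)
  have hinv : (LaurentPolynomial.C a * LaurentPolynomial.T n : K[T;T⁻¹]) *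
      (LaurentPolynomial.C a⁻¹ * LaurentPolynomial.T (-n)) = 1 := by
    rw [mul_mul_mul_comm, ← map_mul, ← LaurentPolynomial.T_add, mul_inv_cancel₀ ha]; simp
  have hsum : (LaurentPolynomial.C γ₁ * LaurentPolynomial.T e +
      LaurentPolynomial.C γ₂ * LaurentPolynomial.T (-e) : K[T;T⁻¹]) =
      LaurentPolynomial.C a * LaurentPolynomial.T n +
      LaurentPolynomial.C a⁻¹ * LaurentPolynomial.T (-n) :=
    sub_eq_iff_eq_add'.1
      ((LaurentPolynomial.isUnit_C_mul_T ha n).mul_left_cancel (hw.trans hinv.symm))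
  have hpos := congrArg (fun u : K[T;T⁻¹] => u.coeff e) hsum
  have hneg := congrArg (fun u : K[T;T⁻¹] => u.coeff (-e)) hsum
  have hne : (e : ℤ) ≠ -e := by omega
  simp only [AddMonoidAlgebra.coeff_add, Finsupp.add_apply, LaurentPolynomial.coeff_C_mul_T,
    if_true, hne, hne.symm, if_false, add_zero, zero_add] at hpos hneg
  have hγ₁ := left_ne_zero_of_mul h0
  by_cases hn : n = e
  · subst hn
    simp only [if_true, hne.symm, hne, if_false, add_zero, zero_add] at hpos hneg
    exact h1 (by rw [hpos, hneg, mul_inv_cancel₀ ha])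
  · by_cases hn' : n = -e
    · subst hn'
      simp only [neg_neg, if_true, hne.symm, hne, if_false, add_zero, zero_add] at hpos hneg
      exact h1 (by rw [hpos, hneg, inv_mul_cancel₀ ha])
    · rw [if_neg hn, if_neg (by omega)] at hpos
      exact hγ₁ (by simpa using hpos)

/-- A Laurent binomial is not a Dickson polynomial of a rational function. -/
theorem dickson_eval_ne_of_isFractionRing {K F : Type*} [Field K] [IsAlgClosed K] [Field F]
    [Algebra K[X] F] [IsFractionRing K[X] F] {l e : ℕ} (hl : 2 ≤ l) (hlK : (l : K) ≠ 0)
    (he : 0 < e) {γ₁ γ₂ : K} (h0 : γ₁ * γ₂ ≠ 0) (h1 : γ₁ * γ₂ ≠ 1) {f : F}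
    (hf : f * algebraMap K[X] F (X ^ e) = algebraMap K[X] F (C γ₁ * X ^ (2 * e) + C γ₂)) (g : F) :
    (dickson 1 (1 : F) l).eval g ≠ f := by
  intro hg
  obtain ⟨k, rfl⟩ : ∃ k, l = k + 1 := ⟨l - 1, by omega⟩
  obtain ⟨hmon, hdeg⟩ := dickson_one_one_monic_natDegree K[X] k
  set q : K[X][X] := C (X ^ e) * dickson 1 (1 : K[X]) (k + 1) - C (C γ₁ * X ^ (2 * e) + C γ₂)
    with hq
  have hXe : (X ^ e : K[X]) ≠ 0 := pow_ne_zero _ X_ne_zero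
  have hlead : q.leadingCoeff = X ^ e := by
    rw [hq, leadingCoeff_sub_of_degree_lt, leadingCoeff_mul, leadingCoeff_C, hmon.leadingCoeff,
      mul_one]
    refine degree_C_le.trans_lt ?_
    rw [degree_mul, degree_C hXe, zero_add, degree_eq_natDegree hmon.ne_zero, hdeg]
    exact_mod_cast k.succ_pos
  have hqg : aeval g q = 0 := by
    have hD : aeval g (dickson 1 (1 : K[X]) (k + 1)) = f := by
      rw [aeval_def, eval₂_eq_eval_map, map_dickson, map_one, hg]
    rw [hq, map_sub, map_mul, aeval_C, aeval_C, hD, ← hf]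
    ring
  let j : K[X] →+* K[T;T⁻¹] := toLaurent.comp (expand K (k + 1)).toRingHom
  have hj : Function.Injective j := toLaurent_injective.comp (expand_injective k.succ_pos)
  have hjC : ∀ c, j (C c) = LaurentPolynomial.C c := fun c => by simp [j]
  have hjX : ∀ n : ℕ, j (X ^ n) = LaurentPolynomial.T ((k + 1 : ℕ) * n) := fun n => by
    rw [← Nat.cast_mul, ← toLaurent_X_pow]; simp [j, pow_mul]
  obtain ⟨s, hs⟩ := exists_eval₂_eq_zero_of_aeval_eq_zero hj
    (by rw [hlead, hjX]; exact LaurentPolynomial.isUnit_T _) hqg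
  refine LaurentPolynomial.dickson_eval_ne hl hlK he h0 h1 s ?_
  rw [hq, eval₂_sub, eval₂_mul, eval₂_C, eval₂_C, eval₂_eq_eval_map, map_dickson, map_one,
    map_add, map_mul, hjC, hjC, hjX, hjX] at hs
  have hT : (LaurentPolynomial.T ((k + 1 : ℕ) * e) *
      LaurentPolynomial.T (-((k + 1 : ℕ) * e)) : K[T;T⁻¹]) = 1 := by
    rw [← LaurentPolynomial.T_add]; simp
  have hT2 : (LaurentPolynomial.T ((k + 1 : ℕ) * (2 * e : ℕ)) : K[T;T⁻¹]) =
      LaurentPolynomial.T ((k + 1 : ℕ) * e) * LaurentPolynomial.T ((k + 1 : ℕ) * e) := by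
    rw [← LaurentPolynomial.T_add]; congr 1; push_cast; ring
  rw [hT2] at hs
  linear_combination LaurentPolynomial.T (-((k + 1 : ℕ) * e)) * hs +
    (LaurentPolynomial.C γ₁ * LaurentPolynomial.T ((k + 1 : ℕ) * e) -
      (dickson 1 (1 : K[T;T⁻¹]) (k + 1)).eval s) * hT

open Module in
/-- In a quadratic extension every element is a root of a monic quadratic whose constant term is
the norm. -/
theorem exists_sq_eq_of_finrank_eq_two {F L : Type*} [Field F] [Field L] [Algebra F L]
    (h : finrank F L = 2) (b : L) :
    ∃ t : F, b ^ 2 - algebraMap F L t * b + algebraMap F L (Algebra.norm F b) = 0 := by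
  have : FiniteDimensional F L := FiniteDimensional.of_finrank_pos (by omega)
  set χ := (Algebra.lmul F L b).charpoly with hχ
  have hdeg : χ.natDegree = 2 := by rw [hχ, LinearMap.charpoly_natDegree, h]
  have hmon : χ.Monic := LinearMap.charpoly_monic _
  have hnorm : Algebra.norm F b = χ.coeff 0 := by
    rw [Algebra.norm_apply, LinearMap.det_eq_sign_charpoly_coeff, h]
    simp [hχ]
  have hb : aeval b χ = 0 := by
    have h' := LinearMap.aeval_self_charpoly (Algebra.lmul F L b)
    rw [← hχ, aeval_algHom_apply] at h'
    simpa using LinearMap.congr_fun h' 1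
  refine ⟨-χ.coeff 1, ?_⟩
  have h2 : χ.coeff 2 = 1 := by rw [← hdeg]; exact hmon
  rw [aeval_eq_sum_range, hdeg] at hb
  simp only [Finset.sum_range_succ, Finset.sum_range_zero, h2, Algebra.smul_def, map_one,
    pow_zero, pow_one, zero_add, one_mul, mul_one] at hb
  rw [hnorm, map_neg]
  linear_combination hb

theorem IsAlgClosed.mem_range_algebraMap_of_pow_eq_one {K F : Type*} [Field K] [IsAlgClosed K]
    [Field F] [Algebra K F] {n : F} {l : ℕ} (hl : 0 < l) (hn : n ^ l = 1) :
    ∃ c : K, algebraMap K F c = n := by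
  have hint : IsIntegral K n := IsIntegral.of_pow hl (by rw [hn]; exact isIntegral_one)
  exact minpoly.mem_range_of_degree_eq_one K n
    (IsAlgClosed.degree_eq_one_of_irreducible K (minpoly.irreducible hint))

/-- If `α` is a quadratic unit of norm one and trace `f`, and `α` is an `l`-th power, then up to
sign `f` is a value of the `l`-th Dickson polynomial. -/
theorem exists_dickson_eval_eq {K F L : Type*} [Field K] [IsAlgClosed K] [Field F] [Algebra K F]
    [Field L] [Algebra F L] (hL : Module.finrank F L = 2) {α : L} {f : F}
    (hα : α ^ 2 - algebraMap F L f * α + 1 = 0) (hN : Algebra.norm F α = 1) {l : ℕ} (hl : 0 < l)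
    {b : L} (hb : b ^ l = α) :
    ∃ (ε : K) (g : F), ε ^ 2 = 1 ∧ (dickson 1 (1 : F) l).eval g = algebraMap K F ε * f := by
  obtain ⟨t, ht⟩ := exists_sq_eq_of_finrank_eq_two hL b
  have hn : Algebra.norm F b ^ l = 1 := by rw [← map_pow, hb, hN]
  obtain ⟨c, hc⟩ := IsAlgClosed.mem_range_algebraMap_of_pow_eq_one (K := K) hl hn
  have hcl : c ^ l = 1 := (algebraMap K F).injective (by rw [map_pow, hc, hn, map_one])
  obtain ⟨η, hη⟩ := IsAlgClosed.exists_pow_nat_eq c two_pos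
  have hη0 : η ≠ 0 := by
    rintro rfl
    rw [← hη, zero_pow two_ne_zero, zero_pow hl.ne'] at hcl
    exact zero_ne_one hcl
  have hε : (η ^ l) ^ 2 = 1 := by rw [← pow_mul, mul_comm, pow_mul, hη, hcl]
  refine ⟨η ^ l, algebraMap K F η⁻¹ * t, hε, (algebraMap F L).injective ?_⟩
  let i : K →+* L := (algebraMap F L).comp (algebraMap K F)
  have hi : ∀ x, algebraMap F L (algebraMap K F x) = i x := fun _ => rfl
  rw [← hc, hi, ← hη, map_pow] at ht
  have hiη : i η ≠ 0 := (map_ne_zero i).2 hη0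
  have hb0 : b ≠ 0 := by
    rintro rfl
    rw [zero_pow hl.ne'] at hb
    simp [← hb] at hα
  have hbinv : b * (algebraMap F L t - b) = i η ^ 2 := by linear_combination -ht
  have hprod : ((i η)⁻¹ * b) * ((i η)⁻¹ * (algebraMap F L t - b)) = 1 := by
    rw [mul_mul_mul_comm, hbinv]
    field_simp
  have hD := dickson_one_one_eval_add_inv _ _ hprod l
  have hα' : α * (algebraMap F L f - α) = 1 := by linear_combination -hα
  have hα0 : α ≠ 0 := left_ne_zero_of_mul_eq_one hα'
  have hiε : (i η ^ l) ^ 2 = 1 := by rw [← map_pow, ← map_pow, hε, map_one]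
  have hiε0 : i η ^ l ≠ 0 := pow_ne_zero _ hiη
  have hconj : (algebraMap F L t - b) ^ l = algebraMap F L f - α := by
    refine mul_left_cancel₀ hα0 ?_
    rw [hα', ← hb, ← mul_pow, hbinv, ← pow_mul, mul_comm, pow_mul, hiε]
  rw [← eval_map_apply, map_dickson, map_one, map_mul, map_mul, hi, hi, map_inv₀, map_pow]
  rw [← mul_add, add_sub_cancel, mul_pow, mul_pow, hconj, hb, inv_pow] at hD
  rw [hD, ← mul_add, add_sub_cancel]
  congr 1
  exact inv_eq_of_mul_eq_one_left (by rw [← sq, hiε])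

open IntermediateField in
theorem irreducible_quadratic_comp_X_pow {K F : Type*} [Field K] [IsAlgClosed K] [Field F]
    [Algebra K[X] F] [IsFractionRing K[X] F] {d e : ℕ} (hd : (d : K) ≠ 0)
    (he : 0 < e) {γ₁ γ₂ : K} (h0 : γ₁ * γ₂ ≠ 0) (h1 : γ₁ * γ₂ ≠ 1) {f : F}
    (hf : f * algebraMap K[X] F (X ^ e) = algebraMap K[X] F (C γ₁ * X ^ (2 * e) + C γ₂)) :
    Irreducible ((X ^ 2 - C f * X + 1 : F[X]).comp (X ^ d)) := by
  let : Algebra K F := ((algebraMap K[X] F).comp C).toAlgebra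
  have hKF : ∀ x : K, algebraMap K F x = algebraMap K[X] F (C x) := fun _ => rfl
  have hd0 : d ≠ 0 := by rintro rfl; simp at hd
  have hirr := irreducible_quadratic he h0 h1 hf
  have hdeg : (X ^ 2 - C f * X + 1 : F[X]).natDegree = 2 := by compute_degree!
  have hmon : (X ^ 2 - C f * X + 1 : F[X]).Monic := by monicity!
  refine irreducible_comp hmon (monic_X_pow d) hirr fun E _ _ x hx => ?_
  have hxint : IsIntegral F x := by
    by_contra h
    rw [minpoly.eq_zero h] at hx
    exact hmon.ne_zero hx.symm
  obtain ⟨i, hi⟩ := IsAlgClosed.exists_pow_nat_eq (-1 : K) two_pos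
  rw [Polynomial.map_pow, map_X]
  refine X_pow_sub_C_irreducible_of_sq_eq_neg_one hd0
    (i := algebraMap F F⟮x⟯ (algebraMap K F i)) (by rw [← map_pow, ← map_pow, hi]; simp) ?_
  intro l hl hld b hb
  have hL : Module.finrank F F⟮x⟯ = 2 := by rw [adjoin.finrank hxint, hx, hdeg]
  have hα : AdjoinSimple.gen F x ^ 2 - algebraMap F F⟮x⟯ f * AdjoinSimple.gen F x + 1 = 0 := by
    have h := minpoly.aeval F (AdjoinSimple.gen F x)
    rw [minpoly_gen, hx] at h
    simpa using h
  have hN : Algebra.norm F (AdjoinSimple.gen F x) = 1 := by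
    rw [← adjoin.powerBasis_gen hxint, Algebra.PowerBasis.norm_gen_eq_coeff_zero_minpoly]
    simp [minpoly_gen, hx, hdeg]
  obtain ⟨ε, g, hε, hg⟩ := exists_dickson_eval_eq (K := K) hL hα hN hl.pos hb
  have hlK : (l : K) ≠ 0 := by
    obtain ⟨k, rfl⟩ := hld
    rw [Nat.cast_mul] at hd
    exact left_ne_zero_of_mul hd
  have hprod : ε * γ₁ * (ε * γ₂) = γ₁ * γ₂ := by linear_combination γ₁ * γ₂ * hε
  refine dickson_eval_ne_of_isFractionRing hl.two_le hlK he (γ₁ := ε * γ₁) (γ₂ := ε * γ₂)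
    (by rwa [hprod]) (by rwa [hprod]) ?_ g hg
  rw [mul_assoc, hf, hKF, ← map_mul]
  congr 1
  simp only [map_mul]
  ring

theorem irreducible_markoff {K : Type*} [Field K] [IsAlgClosed K] {d e : ℕ} (hd : (d : K) ≠ 0)
    (he : 0 < e) {γ₁ γ₂ : K} (h0 : γ₁ * γ₂ ≠ 0) (h1 : γ₁ * γ₂ ≠ 1) :
    Irreducible (C (C γ₁) * X ^ d * C X ^ (2 * e) + C (C γ₂) * X ^ d
      - X ^ (2 * d) * C X ^ e - C X ^ e : K[X][X]) := by
  have hd0 : d ≠ 0 := by rintro rfl; simp at hd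
  have hprim : (C (C γ₁) * X ^ d * C X ^ (2 * e) + C (C γ₂) * X ^ d
      - X ^ (2 * d) * C X ^ e - C X ^ e : K[X][X]).IsPrimitive := by
    intro r hr
    rw [C_dvd_iff_dvd_coeff] at hr
    have hcoeff : ∀ n, (C (C γ₁) * X ^ d * C X ^ (2 * e) + C (C γ₂) * X ^ d
      - X ^ (2 * d) * C X ^ e - C X ^ e : K[X][X]).coeff n =
        (if n = d then C γ₁ * X ^ (2 * e) + C γ₂ else 0) - (if n = 2 * d then X ^ e else 0)
          - (if n = 0 then X ^ e else 0) := by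
      intro n
      have : (C (C γ₁) * X ^ d * C X ^ (2 * e) + C (C γ₂) * X ^ d
        - X ^ (2 * d) * C X ^ e - C X ^ e : K[X][X]) = C (C γ₁ * X ^ (2 * e) + C γ₂) * X ^ d
        - C (X ^ e) * X ^ (2 * d) - C (X ^ e) := by
        simp only [map_add, map_mul, map_pow]; ring
      rw [this, coeff_sub, coeff_sub, coeff_C_mul_X_pow, coeff_C_mul_X_pow, coeff_C]
    have hr0 := hr 0
    have hrd := hr d
    rw [hcoeff, if_neg hd0.symm, if_neg (by omega), if_pos rfl] at hr0
    rw [hcoeff, if_pos rfl, if_neg (by omega), if_neg hd0, sub_zero, sub_zero] at hrd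
    have hrX : r ∣ X ^ e := by simpa using hr0
    have hrγ : r ∣ C γ₂ := by
      refine (dvd_add_right (dvd_mul_of_dvd_right (hrX.trans (pow_dvd_pow _ ?_)) _)).1 hrd
      omega
    exact isUnit_of_dvd_unit hrγ ((right_ne_zero_of_mul h0).isUnit.map C)
  rw [hprim.irreducible_iff_irreducible_map_fraction_map (K := FractionRing K[X])]
  set y := algebraMap K[X] (FractionRing K[X]) X with hy
  have hy0 : y ^ e ≠ 0 := pow_ne_zero _
    ((map_ne_zero_iff _ (IsFractionRing.injective K[X] (FractionRing K[X]))).2 X_ne_zero)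
  set f := algebraMap K[X] (FractionRing K[X]) (C γ₁ * X ^ (2 * e) + C γ₂) / y ^ e with hf
  have hfy : f * algebraMap K[X] (FractionRing K[X]) (X ^ e) =
      algebraMap K[X] (FractionRing K[X]) (C γ₁ * X ^ (2 * e) + C γ₂) := by
    rw [map_pow, ← hy, hf, div_mul_cancel₀ _ hy0]
  refine (Associated.irreducible_iff ?_).1 (irreducible_quadratic_comp_X_pow hd he h0 h1 hfy)
  have hu : IsUnit (C (-y ^ e)) := (neg_ne_zero.2 hy0).isUnit.map C
  refine ⟨hu.unit, ?_⟩
  have hfC := congrArg C hfy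
  rw [map_pow, ← hy] at hfC
  simp only [IsUnit.unit_spec, Polynomial.map_add, Polynomial.map_sub, Polynomial.map_mul,
    Polynomial.map_pow, map_C, map_X, add_comp, sub_comp, mul_comp, X_pow_comp, C_comp, X_comp,
    one_comp, map_neg, map_pow, map_mul, map_add, ← hy] at hfC ⊢
  linear_combination X ^ d * hfC

end

open MvPolynomial in
theorem markoff_curve_absolutely_irreducible (p : ℕ) [hp : Fact p.Prime]
    (K : Type) [Field K] [Algebra (ZMod p) K] [IsAlgClosure (ZMod p) K]
    (d e : ℕ) (hd : 0 < d) (he : 0 < e) (hpde : ¬ (p ∣ d * e))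
    (γ₁ γ₂ : K) (h0 : γ₁ * γ₂ ≠ 0) (h1 : γ₁ * γ₂ ≠ 1) :
    Irreducible (C γ₁ * X 0 ^ d * X 1 ^ (2 * e) + C γ₂ * X 0 ^ d
      - X 0 ^ (2 * d) * X 1 ^ e - X 1 ^ e : MvPolynomial (Fin 2) K) := by
  have : IsAlgClosed K := IsAlgClosure.isAlgClosed (ZMod p)
  have : CharP K p := charP_of_injective_algebraMap (algebraMap (ZMod p) K).injective p
  have hdK : (d : K) ≠ 0 := fun h =>
    hpde (dvd_mul_of_dvd_left ((CharP.cast_eq_zero_iff K p d).1 h) e)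
  let φ : MvPolynomial (Fin 2) K ≃+* Polynomial (Polynomial K) :=
    (finSuccEquiv K 1).toRingEquiv.trans
      (Polynomial.mapEquiv (MvPolynomial.uniqueAlgEquiv K (Fin 1)).toRingEquiv)
  have hφC : ∀ c, φ (C c) = Polynomial.C (Polynomial.C c) := fun c => by
    simp [φ, finSuccEquiv_apply]
  have hφ0 : φ (X 0) = Polynomial.X := by simp [φ, finSuccEquiv_X_zero]
  have hφ1 : φ (X 1) = Polynomial.C Polynomial.X := by
    have h := finSuccEquiv_X_succ (R := K) (n := 1) (j := 0)
    rw [Fin.succ_zero_eq_one] at h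
    simp [φ, h]
  rw [← MulEquiv.irreducible_iff φ]
  simp only [map_sub, map_add, map_mul, map_pow, hφC, hφ0, hφ1]
  exact irreducible_markoff hdK he h0 h1
end
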